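/- arXiv:2007.02665 — 2 statements merged into one kernel-verified Lean document; each statement's English description precedes it below -/
import Mathlib

section
/- Suppose the C² cost function c satisfies conditions A1, A2, Ω and Ω* are c-convex with respect to each other, and c satisfies condition A3v. Fix x₀ ∈ Ω and y₀, y₁ ∈ Ω*, and let θ ↦ y_θ be the c-segment from y₀ to y₁ with respect to x₀. For θ ∈ [0,1] define the section S_θ = {x ∈ Ω : c(x,y₀) − c(x₀,y₀) ≤ c(x,y_θ) − c(x₀,y_θ)}. Then the sections are non-increasing in θ: for 0 ≤ θ ≤ θ′ ≤ 1 one has S_{θ′} ⊆ S_θ. -/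
open Set Filter Topology MeasureTheory RealInnerProductSpace

noncomputable section

/-- Euclidean space ℝⁿ. -/
abbrev E (n : ℕ) := EuclideanSpace ℝ (Fin n)

/-- Partial gradient of the cost in the `x` variable. -/
noncomputable def Dx {n : ℕ} (c : E n → E n → ℝ) (x y : E n) : E n :=
  gradient (fun x' => c x' y) x

/-- Partial gradient of the cost in the `y` variable. -/
noncomputable def Dy {n : ℕ} (c : E n → E n → ℝ) (x y : E n) : E n :=
  gradient (fun y' => c x y') y

/-- Mixed second derivative `D²_{xy} c (x,y)`, as the derivative in `y` of `x ↦ D_x c(x,y)`,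
a continuous linear map acting on vectors of ℝⁿ. -/
noncomputable def Dxy {n : ℕ} (c : E n → E n → ℝ) (x y : E n) : E n →L[ℝ] E n :=
  fderiv ℝ (fun y' => Dx c x y') y

/-- Quadratic form of the Hessian `D²_{xx} c(x,y)` evaluated at `ξ`. -/
noncomputable def DxxQ {n : ℕ} (c : E n → E n → ℝ) (x y ξ : E n) : ℝ :=
  ⟪(fderiv ℝ (fun x' => Dx c x' y) x) ξ, ξ⟫

/-- `Ω` is a bounded open connected domain. -/
def NiceDomain {n : ℕ} (Ω : Set (E n)) : Prop :=
  Bornology.IsBounded Ω ∧ IsOpen Ω ∧ IsConnected Ω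

/-- The cost function is C² on an open neighbourhood of `Ω × Ω*`. -/
def CostC2 {n : ℕ} (Ω Ωs : Set (E n)) (c : E n → E n → ℝ) : Prop :=
  ∃ U : Set (E n × E n), IsOpen U ∧ Ω ×ˢ Ωs ⊆ U ∧ ContDiffOn ℝ 2 (fun p => c p.1 p.2) U

/-- Condition A1: injectivity of `y ↦ -D_x c(x,y)` on `Ω*` and of `x ↦ -D_y c(x,y)` on `Ω`. -/
def CondA1 {n : ℕ} (Ω Ωs : Set (E n)) (c : E n → E n → ℝ) : Prop :=
  (∀ x ∈ Ω, Set.InjOn (fun y => -Dx c x y) Ωs) ∧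
  (∀ y ∈ Ωs, Set.InjOn (fun x => -Dy c x y) Ω)

/-- Condition A2: invertibility of the mixed second derivative `D²_{xy} c`. -/
def CondA2 {n : ℕ} (Ω Ωs : Set (E n)) (c : E n → E n → ℝ) : Prop :=
  ∀ x ∈ Ω, ∀ y ∈ Ωs, Function.Bijective (Dxy c x y)

/-- `Ω` and `Ω*` are c-convex with respect to each other. -/
def MutuallyCConvex {n : ℕ} (Ω Ωs : Set (E n)) (c : E n → E n → ℝ) : Prop :=
  (∀ x ∈ Ω, Convex ℝ ((fun y => -Dx c x y) '' Ωs)) ∧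
  (∀ y ∈ Ωs, Convex ℝ ((fun x => -Dy c x y) '' Ω))

/-- Condition A3v: for every point `y_θ` of the c-segment from `y₀` to `y₁` with respect to `x₀`,
`max{c(x₀,y₀) − c(x,y₀), c(x₀,y₁) − c(x,y₁)} ≥ c(x₀,y_θ) − c(x,y_θ) + o(|x−x₀|²)` as `x → x₀`. -/
def CondA3v {n : ℕ} (Ω Ωs : Set (E n)) (c : E n → E n → ℝ) : Prop :=
  ∀ x₀ ∈ Ω, ∀ y₀ ∈ Ωs, ∀ y₁ ∈ Ωs, ∀ θ ∈ Ioo (0:ℝ) 1, ∀ yθ ∈ Ωs,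
    -Dx c x₀ yθ = (1 - θ) • (-Dx c x₀ y₀) + θ • (-Dx c x₀ y₁) →
    ∃ η : ℝ → ℝ, Tendsto η (𝓝[>] (0:ℝ)) (𝓝 0) ∧
      ∀ x ∈ Ω, max (c x₀ y₀ - c x y₀) (c x₀ y₁ - c x y₁) ≥
        c x₀ yθ - c x yθ - η ‖x - x₀‖ * ‖x - x₀‖ ^ 2

/-- `φ` is (globally) c-convex on `Ω`: it admits a global c-support at every point. -/
def CConvex {n : ℕ} (Ω Ωs : Set (E n)) (c : E n → E n → ℝ) (φ : E n → ℝ) : Prop :=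
  ∀ x₀ ∈ Ω, ∃ y₀ ∈ Ωs, ∃ l : ℝ, (∀ x ∈ Ω, φ x ≥ -l - c x y₀) ∧ φ x₀ = -l - c x₀ y₀

/-- The c-transform `φ^c(y) = sup_{x ∈ Ω} (−φ(x) − c(x,y))`. -/
noncomputable def CTransform {n : ℕ} (Ω : Set (E n)) (c : E n → E n → ℝ) (φ : E n → ℝ)
    (y : E n) : ℝ :=
  sSup ((fun x => -φ x - c x y) '' Ω)


/-- Working package of calculus facts. -/
structure Good {n : ℕ} (Ω Ωs : Set (E n)) (c : E n → E n → ℝ) : Prop where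
  oΩ : IsOpen Ω
  oΩs : IsOpen Ωs
  gx : ∀ x ∈ Ω, ∀ y ∈ Ωs, HasFDerivAt (fun x' => c x' y) (innerSL ℝ (Dx c x y)) x
  gy : ∀ x ∈ Ω, ∀ y ∈ Ωs, HasFDerivAt (fun y' => c x y') (innerSL ℝ (Dy c x y)) y
  sP : ∀ x ∈ Ω, ∀ y ∈ Ωs, ContDiffAt ℝ 1 (fun z : E n × E n => Dx c z.1 z.2) (x, y)
  sR : ∀ x ∈ Ω, ∀ y ∈ Ωs, ContDiffAt ℝ 1 (fun z : E n × E n => Dy c z.1 z.2) (x, y)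
  sym : ∀ x ∈ Ω, ∀ y ∈ Ωs, ∀ ξ v : E n,
    ⟪Dxy c x y v, ξ⟫ = ⟪fderiv ℝ (fun x' => Dy c x' y) x ξ, v⟫

theorem good_of {n : ℕ} {Ω Ωs : Set (E n)} {c : E n → E n → ℝ} (oΩ : IsOpen Ω) (oΩs : IsOpen Ωs)
    (hc : CostC2 Ω Ωs c) : Good Ω Ωs c := by
  obtain ⟨U, hU, hsub, hcd⟩ := hc
  set C : E n × E n → ℝ := fun p => c p.1 p.2 with hC
  have hCat : ∀ x ∈ Ω, ∀ y ∈ Ωs, ContDiffAt ℝ 2 C (x, y) := fun x hx y hy =>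
    hcd.contDiffAt (hU.mem_nhds (hsub ⟨hx, hy⟩))
  have hCd : ∀ x ∈ Ω, ∀ y ∈ Ωs, HasFDerivAt C (fderiv ℝ C (x, y)) (x, y) := fun x hx y hy =>
    ((hCat x hx y hy).differentiableAt (by norm_num)).hasFDerivAt
  have hx1 : ∀ x ∈ Ω, ∀ y ∈ Ωs, HasFDerivAt (fun x' => c x' y)
      ((fderiv ℝ C (x, y)).comp (ContinuousLinearMap.inl ℝ (E n) (E n))) x := by
    intro x hx y hy
    exact HasFDerivAt.comp (g := C) (f := fun e => (e, y)) x (hCd x hx y hy)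
      (hasFDerivAt_prodMk_left x y)
  have hy1 : ∀ x ∈ Ω, ∀ y ∈ Ωs, HasFDerivAt (fun y' => c x y')
      ((fderiv ℝ C (x, y)).comp (ContinuousLinearMap.inr ℝ (E n) (E n))) y := by
    intro x hx y hy
    exact HasFDerivAt.comp (g := C) (f := fun e => (x, e)) y (hCd x hx y hy)
      (hasFDerivAt_prodMk_right x y)
  have eDx : ∀ x ∈ Ω, ∀ y ∈ Ωs, Dx c x y = (InnerProductSpace.toDual ℝ (E n)).symm
      ((fderiv ℝ C (x, y)).comp (ContinuousLinearMap.inl ℝ (E n) (E n))) := by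
    intro x hx y hy
    simp only [Dx, gradient, (hx1 x hx y hy).fderiv]
  have eDy : ∀ x ∈ Ω, ∀ y ∈ Ωs, Dy c x y = (InnerProductSpace.toDual ℝ (E n)).symm
      ((fderiv ℝ C (x, y)).comp (ContinuousLinearMap.inr ℝ (E n) (E n))) := by
    intro x hx y hy
    simp only [Dy, gradient, (hy1 x hx y hy).fderiv]
  have iDx : ∀ x ∈ Ω, ∀ y ∈ Ωs, ∀ ξ, ⟪Dx c x y, ξ⟫ = fderiv ℝ C (x, y) (ξ, 0) := by
    intro x hx y hy ξ
    rw [eDx x hx y hy, InnerProductSpace.toDual_symm_apply]; simp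
  have iDy : ∀ x ∈ Ω, ∀ y ∈ Ωs, ∀ ξ, ⟪Dy c x y, ξ⟫ = fderiv ℝ C (x, y) (0, ξ) := by
    intro x hx y hy ξ
    rw [eDy x hx y hy, InnerProductSpace.toDual_symm_apply]; simp
  have hnear : ∀ x ∈ Ω, ∀ y ∈ Ωs, ∀ᶠ z : E n × E n in 𝓝 (x, y), z.1 ∈ Ω ∧ z.2 ∈ Ωs := by
    intro x hx y hy
    filter_upwards [(oΩ.prod oΩs).mem_nhds (show (x, y) ∈ Ω ×ˢ Ωs from ⟨hx, hy⟩)] with z hz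
    exact hz
  have hd1 : ∀ x ∈ Ω, ∀ y ∈ Ωs, ContDiffAt ℝ 1 (fderiv ℝ C) (x, y) := fun x hx y hy =>
    (hCat x hx y hy).fderiv_right (by norm_num)
  have sP : ∀ x ∈ Ω, ∀ y ∈ Ωs, ContDiffAt ℝ 1 (fun z : E n × E n => Dx c z.1 z.2) (x, y) := by
    intro x hx y hy
    have : ContDiffAt ℝ 1 (fun z : E n × E n => (InnerProductSpace.toDual ℝ (E n)).symm
      ((fderiv ℝ C z).comp (ContinuousLinearMap.inl ℝ (E n) (E n)))) (x, y) := by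
      have h2 := (hd1 x hx y hy).clm_comp
        (contDiffAt_const (c := ContinuousLinearMap.inl ℝ (E n) (E n)))
      exact ((InnerProductSpace.toDual ℝ (E n)).symm.contDiff.contDiffAt).comp (x, y) h2
    refine this.congr_of_eventuallyEq ?_
    filter_upwards [hnear x hx y hy] with z hz
    exact eDx z.1 hz.1 z.2 hz.2
  have sR : ∀ x ∈ Ω, ∀ y ∈ Ωs, ContDiffAt ℝ 1 (fun z : E n × E n => Dy c z.1 z.2) (x, y) := by
    intro x hx y hy
    have : ContDiffAt ℝ 1 (fun z : E n × E n => (InnerProductSpace.toDual ℝ (E n)).symm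
      ((fderiv ℝ C z).comp (ContinuousLinearMap.inr ℝ (E n) (E n)))) (x, y) := by
      have h2 := (hd1 x hx y hy).clm_comp
        (contDiffAt_const (c := ContinuousLinearMap.inr ℝ (E n) (E n)))
      exact ((InnerProductSpace.toDual ℝ (E n)).symm.contDiff.contDiffAt).comp (x, y) h2
    refine this.congr_of_eventuallyEq ?_
    filter_upwards [hnear x hx y hy] with z hz
    exact eDy z.1 hz.1 z.2 hz.2
  refine ⟨oΩ, oΩs, ?_, ?_, sP, sR, ?_⟩
  · intro x hx y hy
    have h : innerSL ℝ (Dx c x y)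
        = (fderiv ℝ C (x, y)).comp (ContinuousLinearMap.inl ℝ (E n) (E n)) := by
      apply ContinuousLinearMap.ext
      intro ξ
      simp [iDx x hx y hy ξ]
    rw [h]
    exact hx1 x hx y hy
  · intro x hx y hy
    have h : innerSL ℝ (Dy c x y)
        = (fderiv ℝ C (x, y)).comp (ContinuousLinearMap.inr ℝ (E n) (E n)) := by
      apply ContinuousLinearMap.ext
      intro ξ
      simp [iDy x hx y hy ξ]
    rw [h]
    exact hy1 x hx y hy
  · intro x hx y hy ξ v
    have hD2 : HasFDerivAt (fderiv ℝ C) (fderiv ℝ (fderiv ℝ C) (x, y)) (x, y) :=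
      ((hd1 x hx y hy).differentiableAt (by norm_num)).hasFDerivAt
    have hsymm : fderiv ℝ (fderiv ℝ C) (x, y) (0, v) (ξ, 0)
        = fderiv ℝ (fderiv ℝ C) (x, y) (ξ, 0) (0, v) :=
      (hCat x hx y hy).isSymmSndFDerivAt (by simp) _ _
    have hPd : DifferentiableAt ℝ (fun y' => Dx c x y') y :=
      DifferentiableAt.comp (g := fun z : E n × E n => Dx c z.1 z.2) (f := fun e => (x, e)) y
        ((sP x hx y hy).differentiableAt (by norm_num))
        (hasFDerivAt_prodMk_right (𝕜 := ℝ) x y).differentiableAt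
    have hRd : DifferentiableAt ℝ (fun x' => Dy c x' y) x :=
      DifferentiableAt.comp (g := fun z : E n × E n => Dy c z.1 z.2) (f := fun e => (e, y)) x
        ((sR x hx y hy).differentiableAt (by norm_num))
        (hasFDerivAt_prodMk_left (𝕜 := ℝ) x y).differentiableAt
    have a1 : HasFDerivAt (fun y' => ⟪ξ, Dx c x y'⟫)
        ((innerSL ℝ ξ).comp (fderiv ℝ (fun y' => Dx c x y') y)) y :=
      (innerSL ℝ ξ).hasFDerivAt.comp y hPd.hasFDerivAt
    have a2 : HasFDerivAt (fun y' => fderiv ℝ C (x, y') (ξ, 0))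
        ((ContinuousLinearMap.apply ℝ ℝ ((ξ, 0) : E n × E n)).comp
          ((fderiv ℝ (fderiv ℝ C) (x, y)).comp (ContinuousLinearMap.inr ℝ (E n) (E n)))) y :=
      (ContinuousLinearMap.apply ℝ ℝ ((ξ, 0) : E n × E n)).hasFDerivAt.comp y
        (hD2.comp y (hasFDerivAt_prodMk_right x y))
    have a3 := a1.unique (a2.congr_of_eventuallyEq (by
      filter_upwards [oΩs.mem_nhds hy] with y' hy'
      rw [real_inner_comm]; exact iDx x hx y' hy' ξ))
    have b1 : HasFDerivAt (fun x' => ⟪v, Dy c x' y⟫)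
        ((innerSL ℝ v).comp (fderiv ℝ (fun x' => Dy c x' y) x)) x :=
      (innerSL ℝ v).hasFDerivAt.comp x hRd.hasFDerivAt
    have b2 : HasFDerivAt (fun x' => fderiv ℝ C (x', y) (0, v))
        ((ContinuousLinearMap.apply ℝ ℝ ((0, v) : E n × E n)).comp
          ((fderiv ℝ (fderiv ℝ C) (x, y)).comp (ContinuousLinearMap.inl ℝ (E n) (E n)))) x :=
      (ContinuousLinearMap.apply ℝ ℝ ((0, v) : E n × E n)).hasFDerivAt.comp x
        (hD2.comp x (hasFDerivAt_prodMk_left x y))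
    have b3 := b1.unique (b2.congr_of_eventuallyEq (by
      filter_upwards [oΩ.mem_nhds hx] with x' hx'
      rw [real_inner_comm]; exact iDy x' hx' y hy v))
    have a4 := DFunLike.congr_fun a3 v
    have b4 := DFunLike.congr_fun b3 ξ
    simp at a4 b4
    rw [real_inner_comm, Dxy, a4, real_inner_comm, b4, hsymm]

theorem chainI {V : Type*} [NormedAddCommGroup V] [InnerProductSpace ℝ V]
    {G : V → ℝ} {g : V} {Q : ℝ → V} {τ : V} {t : ℝ}
    (h : HasFDerivAt G (innerSL ℝ g) (Q t)) (hQ : HasDerivAt Q τ t) :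
    HasDerivAt (fun t => G (Q t)) ⟪g, τ⟫ t :=
  h.comp_hasDerivAt t hQ

theorem lineD {V : Type*} [NormedAddCommGroup V] [InnerProductSpace ℝ V] (a τ : V) (t : ℝ) :
    HasDerivAt (fun t : ℝ => a + t • τ) τ t := by
  have h := ((hasDerivAt_id t).smul_const τ).const_add a
  rw [one_smul] at h
  exact h

/-- One-dimensional argument: every critical point is a right strict local max. -/
theorem oneD {k k' : ℝ → ℝ} {t1 : ℝ} (ht1 : 0 ≤ t1)
    (hk : ∀ t ∈ Icc 0 t1, HasDerivAt k (k' t) t) (h0 : k' 0 = 0)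
    (hcrit : ∀ t ∈ Icc 0 t1, k' t = 0 → ∀ᶠ h in 𝓝[>] (0:ℝ), k (t + h) < k t) :
    k t1 ≤ k 0 := by
  by_contra! hlt
  rcases ht1.eq_or_lt with rfl | hpos
  · exact lt_irrefl _ hlt
  have hcont : ContinuousOn k (Icc 0 t1) := fun t ht => (hk t ht).continuousAt.continuousWithinAt
  obtain ⟨tm, htm, hmin⟩ := isCompact_Icc.exists_isMinOn (nonempty_Icc.2 ht1) hcont
  have hne1 : tm ≠ t1 := by
    rintro rfl
    exact absurd (hmin (left_mem_Icc.2 ht1)) (not_le.2 hlt)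
  have hlt1 : tm < t1 := lt_of_le_of_ne htm.2 hne1
  have hd : k' tm = 0 := by
    rcases htm.1.eq_or_lt with h | h
    · rw [← h]; exact h0
    · exact (hmin.isLocalMin (Icc_mem_nhds h hlt1)).hasDerivAt_eq_zero (hk tm htm)
  have h1 := hcrit tm htm hd
  have h2 : ∀ᶠ h in 𝓝[>] (0:ℝ), h < t1 - tm :=
    mem_nhdsWithin_of_mem_nhds (Iio_mem_nhds (by linarith))
  obtain ⟨h, ha, hb, hc⟩ := (h1.and (h2.and self_mem_nhdsWithin)).exists
  have hc' : 0 < h := hc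
  have : k tm ≤ k (tm + h) := hmin ⟨by linarith [htm.1], by linarith⟩
  linarith

/-- Abstract quasi-convexity lemma. -/
theorem quasi {V : Type*} [NormedAddCommGroup V] [InnerProductSpace ℝ V] [CompleteSpace V]
    {D : Set V} (hD : IsOpen D) (hconv : Convex ℝ D)
    {G : V → ℝ} {G' : V → V} (hG : ∀ q ∈ D, HasFDerivAt G (innerSL ℝ (G' q)) q)
    (hG' : ContinuousOn G' D) (hne : ∀ q ∈ D, G' q ≠ 0)
    (hyp : ∀ q ∈ D, ∀ τ w : V, ⟪G' q, τ⟫ = 0 → 0 < ⟪G' q, w⟫ →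
      ¬ (∀ᶠ t in 𝓝[>] (0:ℝ), G (q + t • τ + t ^ 2 • w) ≤ G q))
    {q0 q1 : V} (h0 : q0 ∈ D) (h1 : q1 ∈ D) (hle : G q1 ≤ G q0) : ⟪G' q0, q1 - q0⟫ ≤ 0 := by
  by_contra! hpos
  set τ := q1 - q0 with hτ
  set Q : ℝ → V := fun t => q0 + t • τ with hQ
  have hQD : ∀ t ∈ Icc (0:ℝ) 1, Q t ∈ D := fun t ht =>
    hconv.add_smul_sub_mem h0 h1 ht
  have hQd : ∀ t, HasDerivAt Q τ t := by
    intro t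
    exact lineD q0 τ t
  have hφd : ∀ t ∈ Icc (0:ℝ) 1, HasDerivAt (fun t => G (Q t)) ⟪G' (Q t), τ⟫ t := by
    intro t ht
    exact chainI (hG _ (hQD t ht)) (hQd t)
  have hφc : ContinuousOn (fun t => G (Q t)) (Icc 0 1) := fun t ht =>
    (hφd t ht).continuousAt.continuousWithinAt
  have hQ0 : Q 0 = q0 := by simp [hQ]
  have hQ1 : Q 1 = q1 := by simp [hQ, hτ]
  obtain ⟨tM, htM, hmax⟩ := isCompact_Icc.exists_isMaxOn (nonempty_Icc.2 zero_le_one) hφc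
  set M := G (Q tM) with hM
  have hmax' : ∀ t ∈ Icc (0:ℝ) 1, G (Q t) ≤ M := fun t ht => hmax ht
  have hM0 : G q0 < M := by
    by_contra! hge
    have hm0 : ∀ t ∈ Icc (0:ℝ) 1, G (Q t) ≤ G (Q 0) := fun t ht => by
      rw [hQ0]; exact (hmax' t ht).trans hge
    have hd := hφd 0 (by simp)
    rw [hQ0] at hd
    have hs : ∀ᶠ t in 𝓝[>] (0:ℝ), 0 < slope (fun t => G (Q t)) 0 t :=
      (hasDerivAt_iff_tendsto_slope.1 hd).mono_left
        (nhdsWithin_mono _ (fun t ht => ne_of_gt ht)) |>.eventually (lt_mem_nhds hpos)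
    have h2 : ∀ᶠ h in 𝓝[>] (0:ℝ), h < 1 :=
      mem_nhdsWithin_of_mem_nhds (Iio_mem_nhds (by norm_num))
    obtain ⟨t, ha, hb, hc⟩ := (hs.and (h2.and self_mem_nhdsWithin)).exists
    have hc' : 0 < t := hc
    have := hm0 t ⟨hc'.le, hb.le⟩
    rw [slope_def_field, sub_zero] at ha
    have := (div_pos_iff_of_pos_right hc').1 ha
    linarith
  -- first maximum point
  set S := {t ∈ Icc (0:ℝ) 1 | G (Q t) = M} with hS
  have hScl : IsCompact S := by
    have : S = Icc 0 1 ∩ (fun t => G (Q t)) ⁻¹' {M} := by ext; simp [hS]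
    rw [this]
    exact isCompact_Icc.of_isClosed_subset
      (hφc.preimage_isClosed_of_isClosed isClosed_Icc isClosed_singleton) inter_subset_left
  obtain ⟨ts, htsS, htsmin⟩ := hScl.exists_isLeast ⟨tM, htM, rfl⟩
  have hts : ts ∈ Icc (0:ℝ) 1 := htsS.1
  have htsM : G (Q ts) = M := htsS.2
  have hts0 : 0 < ts := by
    refine lt_of_le_of_ne hts.1 ?_
    intro h; rw [← h, hQ0] at htsM; linarith
  have hts1 : ts < 1 := by
    refine lt_of_le_of_ne hts.2 ?_
    intro h; rw [h, hQ1] at htsM; linarith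
  have hbefore : ∀ t ∈ Ico (0:ℝ) ts, G (Q t) < M := by
    intro t ht
    refine lt_of_le_of_ne (hmax' t ⟨ht.1, by linarith [ht.2]⟩) ?_
    intro h
    have := htsmin (show t ∈ S from ⟨⟨ht.1, by linarith [ht.2]⟩, h⟩)
    linarith [ht.2]
  set w := G' (Q ts) with hw
  have hwne : w ≠ 0 := hne _ (hQD ts hts)
  have hww : 0 < ⟪w, w⟫ := real_inner_self_pos.2 hwne
  -- neighbourhood
  have hev : ∀ᶠ z : V in 𝓝 (Q ts), z ∈ D ∧ 0 < ⟪G' z, w⟫ := by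
    have hc1 : ContinuousAt G' (Q ts) := hG'.continuousAt (hD.mem_nhds (hQD ts hts))
    have hc2 : ContinuousAt (fun z => ⟪G' z, w⟫) (Q ts) := hc1.inner continuousAt_const
    have hc3 : ∀ᶠ z in 𝓝 (Q ts), z ∈ D := hD.mem_nhds (hQD ts hts)
    exact hc3.and (hc2.eventually (lt_mem_nhds hww))
  have hev2 : ∀ᶠ p : ℝ × ℝ in 𝓝 (ts, 0), (Q p.1 + p.2 • w ∈ D ∧ 0 < ⟪G' (Q p.1 + p.2 • w), w⟫) := by
    have : Tendsto (fun p : ℝ × ℝ => Q p.1 + p.2 • w) (𝓝 (ts, 0)) (𝓝 (Q ts)) := by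
      have hc : Continuous (fun p : ℝ × ℝ => Q p.1 + p.2 • w) := by
        simp only [hQ]; fun_prop
      simpa using hc.tendsto (ts, 0)
    exact this.eventually hev
  obtain ⟨ρ, hρ, hball⟩ := Metric.eventually_nhds_iff.1 hev2
  set r := min (ρ / 2) (min (ts / 2) ((1 - ts) / 2)) with hr
  have hr0 : 0 < r := by
    simp only [hr, lt_min_iff]; refine ⟨by linarith, by linarith, by linarith⟩
  have hrρ : r < ρ := lt_of_le_of_lt (min_le_left _ _) (by linarith)
  have hrts : r < ts := lt_of_le_of_lt ((min_le_right _ _).trans (min_le_left _ _)) (by linarith)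
  have hr1 : r < 1 - ts := lt_of_le_of_lt ((min_le_right _ _).trans (min_le_right _ _)) (by linarith)
  have hreg : ∀ t s : ℝ, |t - ts| ≤ r → |s| ≤ r →
      (Q t + s • w ∈ D ∧ 0 < ⟪G' (Q t + s • w), w⟫) := by
    intro t s ht hs
    apply hball (y := (t, s))
    simp only [Prod.dist_eq, Real.dist_eq, sub_zero, max_lt_iff]
    exact ⟨by linarith, by linarith⟩
  -- derivative along s
  have hds : ∀ t s : ℝ, |t - ts| ≤ r → |s| ≤ r →
      HasDerivAt (fun s => G (Q t + s • w)) ⟪G' (Q t + s • w), w⟫ s := by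
    intro t s ht hs
    exact chainI (Q := fun s : ℝ => Q t + s • w) (hG _ (hreg t s ht hs).1) (lineD (Q t) w s)
  -- strict decrease for negative s
  have hmono : ∀ t s : ℝ, |t - ts| ≤ r → |s| ≤ r → s < 0 → G (Q t + s • w) < G (Q t) := by
    intro t s ht hs hs0
    have hIcc : ∀ u ∈ Icc s 0, |u| ≤ r := fun u hu => by
      rw [abs_of_nonpos hu.2]; rw [abs_of_neg hs0] at hs; linarith [hu.1]
    have := strictMonoOn_of_deriv_pos (convex_Icc s 0) (f := fun s => G (Q t + s • w))
      (fun u hu => (hds t u ht (hIcc u hu)).continuousAt.continuousWithinAt)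
      (fun u hu => by
        rw [interior_Icc] at hu
        have hu' := Ioo_subset_Icc_self hu
        rw [(hds t u ht (hIcc u hu')).deriv]
        exact (hreg t u ht (hIcc u hu')).2)
    simpa using this (left_mem_Icc.2 hs0.le) (right_mem_Icc.2 hs0.le) hs0
  -- choose small slope
  have hleft : ∀ᶠ s in 𝓝 (0:ℝ), G (Q (ts - r) + s • w) < M := by
    have hc := (hds (ts - r) 0 (by simp [abs_of_pos hr0]) (by simpa using hr0.le)).continuousAt
    refine hc.eventually (gt_mem_nhds ?_)
    simpa using hbefore (ts - r) ⟨by linarith, by linarith⟩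
  obtain ⟨σ, hσ, hσb⟩ := Metric.eventually_nhds_iff.1 hleft
  -- β, κ with parabola s = -β u + κ u²
  set β := min (1/2) (σ / (4 * r)) with hβ
  have hβ0 : 0 < β := by simp only [hβ, lt_min_iff]; exact ⟨by norm_num, by positivity⟩
  have hβh : β ≤ 1/2 := min_le_left _ _
  have hβσ : β * r ≤ σ / 4 := by
    have : β ≤ σ / (4 * r) := min_le_right _ _
    calc β * r ≤ σ / (4 * r) * r := by gcongr
      _ = σ / 4 := by field_simp
  set κ := β / (2 * r) with hκ
  have hκ0 : 0 < κ := by positivity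
  have hκr : κ * r = β / 2 := by rw [hκ]; field_simp
  set sf : ℝ → ℝ := fun t => -β * (t - ts) + κ * (t - ts) ^ 2 with hsf
  have hsfb : ∀ t, |t - ts| ≤ r → |sf t| ≤ r := by
    intro t ht
    have h1 : |sf t| ≤ β * |t - ts| + κ * |t - ts| ^ 2 := by
      simp only [hsf]
      refine (abs_add_le _ _).trans ?_
      rw [abs_mul, abs_neg, abs_of_pos hβ0, abs_mul, abs_of_pos hκ0, abs_pow]
    have h2 : κ * |t - ts| ^ 2 ≤ κ * r * r := by
      have := abs_nonneg (t - ts)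
      have : |t - ts| ^ 2 ≤ r * r := by nlinarith
      nlinarith
    have h3 : β * |t - ts| ≤ β * r := by gcongr
    rw [hκr] at h2
    nlinarith
  set γ : ℝ → V := fun t => Q t + sf t • w with hγ
  have hsfd : ∀ t, HasDerivAt sf (-β + 2 * κ * (t - ts)) t := by
    intro t
    have h1 : HasDerivAt (fun t => t - ts) 1 t := (hasDerivAt_id t).sub_const ts
    have h2 := (h1.const_mul (-β)).add ((h1.pow 2).const_mul κ)
    have e : -β + 2 * κ * (t - ts) = -β * 1 + κ * ((2 : ℕ) * (t - ts) ^ (2 - 1) * 1) := by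
      norm_num; ring
    rw [e]
    exact h2
  have hγd : ∀ t, HasDerivAt γ (τ + (-β + 2 * κ * (t - ts)) • w) t := by
    intro t
    exact (hQd t).add ((hsfd t).smul_const w)
  have habs : ∀ t ∈ Icc (ts - r) (ts + r), |t - ts| ≤ r := fun t ht => by
    rw [abs_le]; exact ⟨by linarith [ht.1], by linarith [ht.2]⟩
  have hγD : ∀ t ∈ Icc (ts - r) (ts + r), γ t ∈ D ∧ 0 < ⟪G' (γ t), w⟫ := fun t ht =>
    hreg t (sf t) (habs t ht) (hsfb t (habs t ht))
  have hkd : ∀ t ∈ Icc (ts - r) (ts + r), HasDerivAt (fun t => G (γ t))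
      ⟪G' (γ t), τ + (-β + 2 * κ * (t - ts)) • w⟫ t := by
    intro t ht
    exact chainI (hG _ (hγD t ht).1) (hγd t)
  obtain ⟨tm, htm, hkmax⟩ := isCompact_Icc.exists_isMaxOn
    (nonempty_Icc.2 (show ts - r ≤ ts + r by linarith))
    (fun t ht => (hkd t ht).continuousAt.continuousWithinAt)
  have hge : M ≤ G (γ tm) := by
    have := hkmax (show ts ∈ Icc (ts - r) (ts + r) from ⟨by linarith, by linarith⟩)
    have e : γ ts = Q ts := by simp [hγ, hsf]
    simp only [mem_ofPred_eq, e, htsM] at this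
    exact this
  have hL : tm ≠ ts - r := by
    intro h
    have : G (γ (ts - r)) < M := by
      apply hσb
      have e : sf (ts - r) = β * r + κ * r * r := by simp only [hsf]; ring
      rw [e, hκr, Real.dist_eq, sub_zero, abs_of_pos (by positivity)]
      linarith
    rw [h] at hge; linarith
  have hR : tm ≠ ts + r := by
    intro h
    have e : sf (ts + r) = -β * r + κ * r * r := by simp only [hsf]; ring
    have hb := habs (ts + r) ⟨by linarith, le_rfl⟩
    have : G (γ (ts + r)) < G (Q (ts + r)) := by
      apply hmono _ _ hb (hsfb _ hb)
      rw [e, hκr]; nlinarith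
    have h2 := hmax' (ts + r) ⟨by linarith, by linarith⟩
    rw [h] at hge; linarith
  have htm' : tm ∈ Ioo (ts - r) (ts + r) :=
    ⟨lt_of_le_of_ne htm.1 hL.symm, lt_of_le_of_ne htm.2 hR⟩
  have hnb : Icc (ts - r) (ts + r) ∈ 𝓝 tm := Icc_mem_nhds htm'.1 htm'.2
  have hcrit := (hkmax.isLocalMax hnb).hasDerivAt_eq_zero (hkd tm htm)
  refine hyp (γ tm) (hγD tm htm).1 (τ + (-β + 2 * κ * (tm - ts)) • w) (κ • w) hcrit ?_ ?_
  · rw [inner_smul_right]; exact mul_pos hκ0 (hγD tm htm).2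
  · have ht : Tendsto (fun t : ℝ => tm + t) (𝓝[>] 0) (𝓝 tm) := by
      have : Tendsto (fun t : ℝ => tm + t) (𝓝 0) (𝓝 tm) := by
        have hc : Continuous (fun t : ℝ => tm + t) := by fun_prop
        simpa using hc.tendsto 0
      exact this.mono_left nhdsWithin_le_nhds
    filter_upwards [ht.eventually hnb] with t h
    have e : γ tm + t • (τ + (-β + 2 * κ * (tm - ts)) • w) + t ^ 2 • κ • w = γ (tm + t) := by
      simp only [hγ, hQ, hsf]
      module
    rw [e]
    exact hkmax h

namespace Good

variable {n : ℕ} {Ω Ωs : Set (E n)} {c : E n → E n → ℝ}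

theorem strictP (G : Good Ω Ωs c) {x y : E n} (hx : x ∈ Ω) (hy : y ∈ Ωs) :
    HasStrictFDerivAt (fun z : E n × E n => Dx c z.1 z.2)
      (fderiv ℝ (fun z : E n × E n => Dx c z.1 z.2) (x, y)) (x, y) :=
  (G.sP x hx y hy).hasStrictFDerivAt (by norm_num)

theorem hasB (G : Good Ω Ωs c) {x y : E n} (hx : x ∈ Ω) (hy : y ∈ Ωs) :
    HasFDerivAt (fun x' => Dx c x' y) ((fderiv ℝ (fun z : E n × E n => Dx c z.1 z.2) (x, y)).comp
      (ContinuousLinearMap.inl ℝ (E n) (E n))) x :=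
  HasFDerivAt.comp (g := fun z : E n × E n => Dx c z.1 z.2) (f := fun e => (e, y)) x
    (G.strictP hx hy).hasFDerivAt (hasFDerivAt_prodMk_left x y)

theorem hasB' (G : Good Ω Ωs c) {x y : E n} (hx : x ∈ Ω) (hy : y ∈ Ωs) :
    HasFDerivAt (fun x' => Dx c x' y) (fderiv ℝ (fun x' => Dx c x' y) x) x :=
  (G.hasB hx hy).differentiableAt.hasFDerivAt

theorem hasDxy (G : Good Ω Ωs c) {x y : E n} (hx : x ∈ Ω) (hy : y ∈ Ωs) :
    HasStrictFDerivAt (fun y' => Dx c x y') (Dxy c x y) y := by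
  have h : ContDiffAt ℝ 1 (fun y' => Dx c x y') y :=
    ContDiffAt.comp (g := fun z : E n × E n => Dx c z.1 z.2) (f := fun e => (x, e)) y
      (G.sP x hx y hy) (contDiffAt_const.prodMk contDiffAt_id)
  exact h.hasStrictFDerivAt (by norm_num)

theorem Dxy_eq (G : Good Ω Ωs c) {x y : E n} (hx : x ∈ Ω) (hy : y ∈ Ωs) (v : E n) :
    fderiv ℝ (fun z : E n × E n => Dx c z.1 z.2) (x, y) (0, v) = Dxy c x y v := by
  have h := HasFDerivAt.comp (g := fun z : E n × E n => Dx c z.1 z.2) (f := fun e => (x, e)) y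
    (G.strictP hx hy).hasFDerivAt (hasFDerivAt_prodMk_right x y)
  have := DFunLike.congr_fun (h.unique (G.hasDxy hx hy).hasFDerivAt) v
  simpa using this

theorem contB (G : Good Ω Ωs c) {x y : E n} (hx : x ∈ Ω) (hy : y ∈ Ωs) :
    ContinuousAt (fun z : E n × E n => fderiv ℝ (fun x' => Dx c x' z.2) z.1) (x, y) := by
  have h1 : ContinuousAt (fderiv ℝ (fun z : E n × E n => Dx c z.1 z.2)) (x, y) :=
    ((G.sP x hx y hy).fderiv_right (m := 0) (by norm_num)).continuousAt
  have h2 : ContinuousAt (fun z => (fderiv ℝ (fun z : E n × E n => Dx c z.1 z.2) z).comp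
      (ContinuousLinearMap.inl ℝ (E n) (E n))) (x, y) :=
    h1.clm_comp continuousAt_const
  refine h2.congr ?_
  filter_upwards [(G.oΩ.prod G.oΩs).mem_nhds (show (x, y) ∈ Ω ×ˢ Ωs from ⟨hx, hy⟩)] with z hz
  exact (G.hasB hz.1 hz.2).fderiv.symm

theorem contP (G : Good Ω Ωs c) {x y : E n} (hx : x ∈ Ω) (hy : y ∈ Ωs) :
    ContinuousAt (fun z : E n × E n => Dx c z.1 z.2) (x, y) :=
  (G.sP x hx y hy).continuousAt

/-- gradient of a difference of costs -/
theorem gdiff (G : Good Ω Ωs c) {x y y' : E n} (hx : x ∈ Ω) (hy : y ∈ Ωs) (hy' : y' ∈ Ωs) :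
    HasFDerivAt (fun x' => c x' y - c x' y') (innerSL ℝ (Dx c x y - Dx c x y')) x := by
  rw [map_sub]
  exact (G.gx x hx y hy).sub (G.gx x hx y' hy')

theorem gdiff_strict (G : Good Ω Ωs c) {x y y' : E n} (hx : x ∈ Ω) (hy : y ∈ Ωs) (hy' : y' ∈ Ωs) :
    HasStrictFDerivAt (fun x' => c x' y - c x' y') (innerSL ℝ (Dx c x y - Dx c x y')) x := by
  refine hasStrictFDerivAt_of_hasFDerivAt_of_continuousAt
    (f' := fun x' => innerSL ℝ (Dx c x' y - Dx c x' y')) ?_ ?_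
  · filter_upwards [G.oΩ.mem_nhds hx] with z hz
    exact G.gdiff hz hy hy'
  · exact (innerSL ℝ).continuous.continuousAt.comp
      ((G.hasB hx hy).continuousAt.sub (G.hasB hx hy').continuousAt)

theorem open_map (G : Good Ω Ωs c) (h2 : CondA2 Ω Ωs c) {x y : E n} (hx : x ∈ Ω) (hy : y ∈ Ωs)
    {V : Set (E n × E n)} (hV : V ∈ 𝓝 (x, y)) :
    ∀ᶠ z : E n × E n in 𝓝 (x, Dx c x y), ∃ w, (z.1, w) ∈ V ∧ Dx c z.1 w = z.2 := by
  set F := fderiv ℝ (fun z : E n × E n => Dx c z.1 z.2) (x, y) with hF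
  have hs : HasStrictFDerivAt (fun z : E n × E n => (z.1, Dx c z.1 z.2))
      ((ContinuousLinearMap.fst ℝ (E n) (E n)).prod F) (x, y) :=
    hasStrictFDerivAt_fst.prodMk (G.strictP hx hy)
  have hr : (((ContinuousLinearMap.fst ℝ (E n) (E n)).prod F : E n × E n →L[ℝ] E n × E n)
      : E n × E n →ₗ[ℝ] E n × E n).range = ⊤ := by
    rw [LinearMap.range_eq_top]
    rintro ⟨ξ, p⟩
    obtain ⟨ζ, hζ⟩ := (h2 x hx y hy).2 (p - F (ξ, 0))
    refine ⟨(ξ, ζ), ?_⟩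
    have : F (ξ, ζ) = F (ξ, 0) + F (0, ζ) := by rw [← map_add]; simp
    have h3 : F (0, ζ) = Dxy c x y ζ := G.Dxy_eq hx hy ζ
    simp [this, h3, hζ]
  have hm := hs.map_nhds_eq_of_surj hr
  have : (fun z : E n × E n => (z.1, Dx c z.1 z.2)) '' V ∈ 𝓝 (x, Dx c x y) := by
    rw [← hm]; exact image_mem_map hV
  filter_upwards [this] with z hz
  obtain ⟨u, hu, rfl⟩ := hz
  exact ⟨u.2, hu, rfl⟩

/-- local c-segment -/
theorem curve (G : Good Ω Ωs c) (h2 : CondA2 Ω Ωs c) {x y : E n} (hx : x ∈ Ω) (hy : y ∈ Ωs)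
    (e v : E n) (hv : Dxy c x y v = -e) :
    ∃ Y : ℝ → E n, Y 0 = y ∧ HasDerivAt Y v 0 ∧ ∀ᶠ θ in 𝓝 (0:ℝ), Dx c x (Y θ) = Dx c x y - θ • e := by
  set A : E n ≃L[ℝ] E n := ContinuousLinearEquiv.ofBijective (Dxy c x y)
    (LinearMap.ker_eq_bot.2 (h2 x hx y hy).1) (LinearMap.range_eq_top.2 (h2 x hx y hy).2) with hA
  have hA' : (A : E n →L[ℝ] E n) = Dxy c x y := by ext1 u; simp [hA]
  have hs : HasStrictFDerivAt (fun y' => Dx c x y') (A : E n →L[ℝ] E n) y := by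
    rw [hA']; exact G.hasDxy hx hy
  have hp : HasDerivAt (fun θ : ℝ => Dx c x y + θ • (-e)) (-e) 0 := lineD _ _ _
  have hp0 : Dx c x y + (0:ℝ) • (-e) = Dx c x y := by simp
  refine ⟨fun θ => hs.localInverse _ _ _ (Dx c x y + θ • (-e)), ?_, ?_, ?_⟩
  · simp only [hp0]; exact hs.localInverse_apply_image
  · have h3 := hs.to_localInverse.hasFDerivAt
    have h4 := HasFDerivAt.comp_hasDerivAt (f := fun θ : ℝ => Dx c x y + θ • (-e)) 0
      (by simp only [hp0]; exact h3) hp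
    have h5 : A.symm (-e) = v := by
      rw [← hv, ContinuousLinearEquiv.symm_apply_eq]
      exact (DFunLike.congr_fun hA' v).symm
    simp only [ContinuousLinearEquiv.coe_coe, h5] at h4
    exact h4
  · have h6 := hs.eventually_right_inverse
    have h7 : Tendsto (fun θ : ℝ => Dx c x y + θ • (-e)) (𝓝 0) (𝓝 (Dx c x y)) := by
      have := hp.continuousAt.tendsto
      rwa [hp0] at this
    filter_upwards [h7.eventually h6] with θ hθ
    rw [hθ]; simp [sub_eq_add_neg]

/-- limit of the normalised gradients -/
theorem limN (G : Good Ω Ωs c) {x y v : E n} (hx : x ∈ Ω) (hy : y ∈ Ωs)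
    {Y : ℝ → E n} (hY0 : Y 0 = y) (hY : HasDerivAt Y v 0) :
    Tendsto (fun p : ℝ × E n => p.1⁻¹ • (Dx c p.2 y - Dx c p.2 (Y p.1)))
      (𝓝[>] 0 ×ˢ 𝓝 x) (𝓝 (-Dxy c x y v)) := by
  set F := fderiv ℝ (fun z : E n × E n => Dx c z.1 z.2) (x, y) with hF
  have hs := (G.strictP hx hy).isLittleO
  have t1 : Tendsto (fun p : ℝ × E n => p.1) (𝓝[>] 0 ×ˢ 𝓝 x) (𝓝 0) :=
    tendsto_fst.mono_right nhdsWithin_le_nhds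
  have t2 : Tendsto (fun p : ℝ × E n => p.2) (𝓝[>] 0 ×ˢ 𝓝 x) (𝓝 x) := tendsto_snd
  have tY : Tendsto (fun p : ℝ × E n => Y p.1) (𝓝[>] 0 ×ˢ 𝓝 x) (𝓝 y) := by
    have := hY.continuousAt.tendsto; rw [hY0] at this
    exact this.comp t1
  have tt : Tendsto (fun p : ℝ × E n => (((p.2, y), (p.2, Y p.1)) : (E n × E n) × (E n × E n)))
      (𝓝[>] 0 ×ˢ 𝓝 x) (𝓝 ((x, y), (x, y))) :=
    (t2.prodMk_nhds tendsto_const_nhds).prodMk_nhds (t2.prodMk_nhds tY)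
  have o1 := hs.comp_tendsto tt
  have hslope : Tendsto (fun θ : ℝ => θ⁻¹ • (Y θ - y)) (𝓝[>] 0) (𝓝 v) := by
    have := (hasDerivAt_iff_tendsto_slope.1 hY).mono_left
      (nhdsWithin_mono (0:ℝ) (fun t (ht : 0 < t) => ne_of_gt ht))
    refine this.congr ?_
    intro t; simp [slope_def_module, hY0]
  have hslope2 : Tendsto (fun p : ℝ × E n => p.1⁻¹ • (Y p.1 - y)) (𝓝[>] 0 ×ˢ 𝓝 x) (𝓝 v) :=
    hslope.comp tendsto_fst
  have main : Tendsto (fun p : ℝ × E n => p.1⁻¹ • (Dx c p.2 y - Dx c p.2 (Y p.1)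
      - F ((p.2, y) - (p.2, Y p.1)))) (𝓝[>] 0 ×ˢ 𝓝 x) (𝓝 0) := by
    have o2 : (fun p : ℝ × E n => p.1⁻¹ • (Dx c p.2 y - Dx c p.2 (Y p.1)
      - F ((p.2, y) - (p.2, Y p.1)))) =o[𝓝[>] 0 ×ˢ 𝓝 x]
        (fun p : ℝ × E n => p.1⁻¹ • (((p.2, y) - (p.2, Y p.1)) : E n × E n)) :=
      (Asymptotics.isBigO_refl (fun p : ℝ × E n => p.1⁻¹) _).smul_isLittleO o1
    have o3 : (fun p : ℝ × E n => p.1⁻¹ • (((p.2, y) - (p.2, Y p.1)) : E n × E n))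
        =O[𝓝[>] 0 ×ˢ 𝓝 x] (fun _ => (1:ℝ)) := by
      have : Tendsto (fun p : ℝ × E n => p.1⁻¹ • (((p.2, y) - (p.2, Y p.1)) : E n × E n))
          (𝓝[>] 0 ×ˢ 𝓝 x) (𝓝 ((0, -v) : E n × E n)) := by
        have h := (tendsto_const_nhds (x := (0 : E n))).prodMk_nhds hslope2.neg
        refine h.congr ?_
        intro p
        ext1
        · simp
        · simp [← smul_neg]
      exact this.isBigO_one ℝ
    exact (Asymptotics.isLittleO_one_iff ℝ).1 (o2.trans_isBigO o3)
  have main2 : Tendsto (fun p : ℝ × E n => - F (0, p.1⁻¹ • (Y p.1 - y))) (𝓝[>] 0 ×ˢ 𝓝 x)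
      (𝓝 (-F (0, v))) := by
    have hc : Continuous (fun u : E n => - F (0, u)) := by fun_prop
    exact (hc.tendsto v).comp hslope2
  have := main.add main2
  rw [zero_add, G.Dxy_eq hx hy] at this
  refine this.congr ?_
  intro p
  have e1 : (p.2, y) - (p.2, Y p.1) = ((0, -(Y p.1 - y)) : E n × E n) := by ext1 <;> simp
  have e2 : ((0, p.1⁻¹ • (Y p.1 - y)) : E n × E n) = -(p.1⁻¹ • ((0, -(Y p.1 - y)) : E n × E n)) := by
    ext1
    · simp
    · simp [← smul_neg]
  rw [e1, e2, map_neg, map_smul, smul_sub]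
  simp

end Good

theorem quadD {V : Type*} [NormedAddCommGroup V] [InnerProductSpace ℝ V] (x ξ e : V) (b t : ℝ) :
    HasDerivAt (fun h : ℝ => x + h • ξ + (b * h ^ 2) • e) (ξ + (2 * b * t) • e) t := by
  have h1 := lineD x ξ t
  have h2 : HasDerivAt (fun h : ℝ => b * h ^ 2) (2 * b * t) t := by
    have := ((hasDerivAt_id t).pow 2).const_mul b
    refine this.congr_deriv ?_
    simp; ring
  exact h1.add (h2.smul_const e)

namespace Good

variable {n : ℕ} {Ω Ωs : Set (E n)} {c : E n → E n → ℝ}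

set_option maxHeartbeats 1000000 in
theorem step (G : Good Ω Ωs c) (h3 : CondA3v Ω Ωs c) {x y0 w yθ N ξ e : E n} {θ ρ a : ℝ}
    (hx : x ∈ Ω) (hy0 : y0 ∈ Ωs) (hw : w ∈ Ωs) (hyθ : yθ ∈ Ωs) (hθ : θ ∈ Ioo (0:ℝ) 1)
    (hN : Dx c x y0 - Dx c x w = N) (hNθ : Dx c x y0 - Dx c x yθ = θ • N)
    (hξ : ⟪N, ξ⟫ = 0) (hρ : 0 < ρ) (hNe : 0 < ⟪N, e⟫)
    (hneg : ⟪(fderiv ℝ (fun x' => Dx c x' y0) x - fderiv ℝ (fun x' => Dx c x' w) x) ξ, ξ⟫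
      + (a + 2 * ρ) * ⟪N, e⟫ < 0) :
    ∀ᶠ h in 𝓝[>] (0:ℝ), c (x + h • ξ + (a / 2 * h ^ 2) • e) y0
      - c (x + h • ξ + (a / 2 * h ^ 2) • e) yθ < c x y0 - c x yθ := by
  set b := a / 2 + ρ with hb
  set u : ℝ → E n := fun h => x + h • ξ + (b * h ^ 2) • e with hu
  set m : ℝ → E n := fun h => x + h • ξ + (a / 2 * h ^ 2) • e with hm
  have u0 : u 0 = x := by simp [hu]
  have m0 : m 0 = x := by simp [hm]
  have du : ∀ t, HasDerivAt u (ξ + (2 * b * t) • e) t := fun t => quadD x ξ e b t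
  have cu : Tendsto u (𝓝 0) (𝓝 x) := by
    have := (du 0).continuousAt.tendsto; rwa [u0] at this
  have cm : Tendsto m (𝓝 0) (𝓝 x) := by
    have := (quadD x ξ e (a / 2) 0).continuousAt.tendsto
    change Tendsto m (𝓝 0) (𝓝 (m 0)) at this
    rwa [m0] at this
  have uΩ : ∀ᶠ h in 𝓝 (0:ℝ), u h ∈ Ω := cu.eventually (G.oΩ.mem_nhds hx)
  -- local max
  have lmax : ∀ᶠ h in 𝓝 (0:ℝ), c (u h) y0 - c (u h) w ≤ c x y0 - c x w := by
    have d1 : ∀ᶠ h in 𝓝 (0:ℝ), deriv (fun h => c (u h) y0 - c (u h) w) h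
        = ⟪Dx c (u h) y0 - Dx c (u h) w, ξ + (2 * b * h) • e⟫ := by
      filter_upwards [uΩ] with h hh
      exact (chainI (G.gdiff hh hy0 hw) (du h)).deriv
    have d1' : deriv (fun h => c (u h) y0 - c (u h) w) =ᶠ[𝓝 0]
        fun h => ⟪Dx c (u h) y0 - Dx c (u h) w, ξ + (2 * b * h) • e⟫ := d1
    have d2 : HasDerivAt (fun h => ⟪Dx c (u h) y0 - Dx c (u h) w, ξ + (2 * b * h) • e⟫)
        (⟪N, (2 * b) • e⟫ +
         ⟪(fderiv ℝ (fun x' => Dx c x' y0) x - fderiv ℝ (fun x' => Dx c x' w) x) ξ, ξ⟫) 0 := by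
      have hP : HasFDerivAt (fun x' => Dx c x' y0 - Dx c x' w)
        (fderiv ℝ (fun x' => Dx c x' y0) x - fderiv ℝ (fun x' => Dx c x' w) x) (u 0) := by
        rw [u0]; exact (G.hasB' hx hy0).sub (G.hasB' hx hw)
      have h1 := hP.comp_hasDerivAt 0 (du 0)
      have h2 : HasDerivAt (fun h : ℝ => ξ + (2 * b * h) • e) ((2 * b) • e) 0 := by
        have := lineD ξ ((2 * b) • e) 0
        refine this.congr_of_eventuallyEq (Eventually.of_forall fun h => ?_)
        simp only [smul_smul]; rw [mul_comm]
      have h4 := h1.inner ℝ h2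
      simp only [Function.comp, u0, hN, mul_zero, zero_smul, add_zero] at h4
      exact h4
    have := isLocalMax_of_deriv_deriv_neg (f := fun h => c (u h) y0 - c (u h) w) (x₀ := 0)
      (by rw [d1'.deriv_eq, d2.deriv, inner_smul_right, hb]; linarith)
      (by rw [d1'.self_of_nhds]; simp [u0, hN, hξ])
      (chainI (G.gdiff (by rw [u0]; exact hx) hy0 hw) (du 0)).continuousAt
    filter_upwards [this] with h hh
    simpa [u0] using hh
  obtain ⟨η, hη0, hη⟩ := h3 x hx y0 hy0 w hw θ hθ yθ hyθ (by
    have e1 : Dx c x yθ = Dx c x y0 - θ • N := by rw [← hNθ]; abel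
    have e2 : Dx c x w = Dx c x y0 - N := by rw [← hN]; abel
    rw [e1, e2]; module)
  set κ := θ * ρ * ⟪N, e⟫ with hκ
  have κpos : 0 < κ := mul_pos (mul_pos hθ.1 hρ) hNe
  set K := ‖ξ‖ + |b| * ‖e‖ with hK
  have K0 : 0 ≤ K := by positivity
  have small1 : ∀ᶠ h in 𝓝[>] (0:ℝ), η ‖u h - x‖ * ‖u h - x‖ ^ 2 ≤ κ / 4 * h ^ 2 := by
    have hε : 0 < κ / 4 / (K ^ 2 + 1) := by positivity
    have := hη0.eventually (gt_mem_nhds hε)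
    rw [eventually_nhdsWithin_iff, Metric.eventually_nhds_iff] at this
    obtain ⟨δ, hδ, hd⟩ := this
    have e1 : ∀ᶠ h in 𝓝[>] (0:ℝ), ‖u h - x‖ < δ := by
      have := (cu.mono_left (nhdsWithin_le_nhds (s := Ioi 0))).eventually (Metric.ball_mem_nhds x hδ)
      filter_upwards [this] with h hh
      simpa [dist_eq_norm] using hh
    have e2 : ∀ᶠ h in 𝓝[>] (0:ℝ), h < 1 :=
      nhdsWithin_le_nhds (gt_mem_nhds one_pos)
    filter_upwards [e1, e2, self_mem_nhdsWithin] with h he1 he2 he3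
    have he3 : 0 < h := he3
    rcases (norm_nonneg (u h - x)).eq_or_lt with h0 | h0
    · rw [← h0]; simp; positivity
    · have h4 := hd (y := ‖u h - x‖) (by simpa [dist_eq_norm] using he1) h0
      have h5 : ‖u h - x‖ ≤ K * h := by
        have : u h - x = h • ξ + (b * h ^ 2) • e := by simp [hu]; abel
        rw [this]
        calc _ ≤ ‖h • ξ‖ + ‖(b * h ^ 2) • e‖ := norm_add_le _ _
          _ = h * ‖ξ‖ + |b| * h ^ 2 * ‖e‖ := by
            rw [norm_smul, norm_smul, norm_mul, Real.norm_eq_abs, Real.norm_eq_abs, abs_of_pos he3]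
            simp
          _ ≤ K * h := by
            rw [hK]
            have : |b| * ‖e‖ * h ^ 2 ≤ |b| * ‖e‖ * h := by
              apply mul_le_mul_of_nonneg_left _ (by positivity)
              nlinarith
            nlinarith
      have h6 : ‖u h - x‖ ^ 2 ≤ K ^ 2 * h ^ 2 := by
        rw [← mul_pow]; gcongr
      calc η ‖u h - x‖ * ‖u h - x‖ ^ 2 ≤ (κ / 4 / (K ^ 2 + 1)) * ‖u h - x‖ ^ 2 := by gcongr
        _ ≤ (κ / 4 / (K ^ 2 + 1)) * ((K ^ 2 + 1) * h ^ 2) := by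
            gcongr; nlinarith [sq_nonneg h]
        _ = κ / 4 * h ^ 2 := by field_simp
  have small2 : ∀ᶠ h in 𝓝 (0:ℝ), |(c (u h) y0 - c (u h) yθ) - (c (m h) y0 - c (m h) yθ)
      - κ * h ^ 2| ≤ κ / 4 * h ^ 2 := by
    have hs := (G.gdiff_strict hx hy0 hyθ).isLittleO
    have ht : Tendsto (fun h => (u h, m h)) (𝓝 0) (𝓝 (x, x)) := cu.prodMk_nhds cm
    have hε : 0 < κ / 4 / (ρ * ‖e‖ + 1) := by positivity
    have := (hs.comp_tendsto ht).bound hε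
    filter_upwards [this] with h hh
    have e1 : u h - m h = (ρ * h ^ 2) • e := by
      simp only [hu, hm, hb]; module
    simp only [Function.comp, e1, hNθ, Real.norm_eq_abs, innerSL_apply_apply, inner_smul_left,
      inner_smul_right, norm_smul] at hh
    have e2 : (starRingEnd ℝ) θ * (ρ * h ^ 2 * ⟪N, e⟫) = κ * h ^ 2 := by simp [hκ]; ring
    have e2' : ρ * h ^ 2 * ((starRingEnd ℝ) θ * ⟪N, e⟫) = κ * h ^ 2 := by simp [hκ]; ring
    first | rw [e2] at hh | rw [e2'] at hh
    refine hh.trans ?_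
    have e3 : |ρ * h ^ 2| = ρ * h ^ 2 := abs_of_nonneg (by positivity)
    rw [e3]
    calc _ ≤ κ / 4 / (ρ * ‖e‖ + 1) * ((ρ * ‖e‖ + 1) * h ^ 2) := by
          refine mul_le_mul_of_nonneg_left ?_ hε.le
          linarith [sq_nonneg h, show (ρ * ‖e‖ + 1) * h ^ 2 = ρ * h ^ 2 * ‖e‖ + h ^ 2 by ring]
      _ = _ := by field_simp
  filter_upwards [small1, nhdsWithin_le_nhds small2, nhdsWithin_le_nhds uΩ,
    nhdsWithin_le_nhds lmax, self_mem_nhdsWithin] with h a1 a2 a3 a4 a5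
  have a5 : 0 < h := a5
  have h6 := hη (u h) a3
  rw [max_eq_left (by linarith)] at h6
  have h7 := (abs_le.1 a2).1
  have : 0 < κ * h ^ 2 := by positivity
  change c (m h) y0 - c (m h) yθ < c x y0 - c x yθ
  linarith

end Good

theorem deriv_nonneg_of_right {ψ : ℝ → ℝ} {d : ℝ} (h : HasDerivAt ψ d 0)
    (hge : ∀ᶠ t in 𝓝[>] (0:ℝ), ψ 0 ≤ ψ t) : 0 ≤ d := by
  have : Tendsto (slope ψ 0) (𝓝[>] 0) (𝓝 d) := (hasDerivAt_iff_tendsto_slope.1 h).mono_left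
      (nhdsWithin_mono (0:ℝ) (fun t (ht : 0 < t) => ne_of_gt ht))
  refine ge_of_tendsto this ?_
  filter_upwards [hge, self_mem_nhdsWithin] with t ht ht0
  have ht0 : 0 < t := ht0
  rw [slope_def_field]
  apply div_nonneg <;> linarith

namespace Good

variable {n : ℕ} {Ω Ωs : Set (E n)} {c : E n → E n → ℝ}

set_option maxHeartbeats 1000000 in
theorem K1 (G : Good Ω Ωs c) (h2 : CondA2 Ω Ωs c) (h3 : CondA3v Ω Ωs c)
    {x y0 y1 v η0 e : E n} {a : ℝ}
    (hx : x ∈ Ω) (hy0 : y0 ∈ Ωs) (hy1 : y1 ∈ Ωs) (he : Dx c x y0 - Dx c x y1 = e) (hne : e ≠ 0)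
    (hv : Dxy c x y0 v = -e)
    (hneg : ⟪(fderiv ℝ (fun x' => Dx c x' y0) x - fderiv ℝ (fun x' => Dx c x' y1) x) η0, η0⟫
      + a * ‖e‖ ^ 2 < 0) :
    ∀ᶠ p : ℝ × E n in 𝓝[>] 0 ×ˢ 𝓝 η0, ⟪e, p.2⟫ = 0 →
      ⟪Dy c x y0 - Dy c (x + p.1 • p.2 + (a / 2 * p.1 ^ 2) • e) y0, v⟫ ≤ 0 := by
  have epos : 0 < ‖e‖ ^ 2 := by have := norm_pos_iff.2 hne; positivity
  obtain ⟨ρ, hρ, hneg'⟩ : ∃ ρ > 0,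
      ⟪(fderiv ℝ (fun x' => Dx c x' y0) x - fderiv ℝ (fun x' => Dx c x' y1) x) η0, η0⟫
      + (a + 2 * ρ) * ⟪e, e⟫ < 0 := by
    rw [real_inner_self_eq_norm_sq]
    generalize ⟪(fderiv ℝ (fun x' => Dx c x' y0) x
      - fderiv ℝ (fun x' => Dx c x' y1) x) η0, η0⟫ = q at *
    refine ⟨-(q + a * ‖e‖ ^ 2) / (4 * ‖e‖ ^ 2), div_pos (by linarith) (by linarith), ?_⟩
    have : (a + 2 * (-(q + a * ‖e‖ ^ 2) / (4 * ‖e‖ ^ 2))) * ‖e‖ ^ 2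
      = a * ‖e‖ ^ 2 - (q + a * ‖e‖ ^ 2) / 2 := by field_simp; ring
    linarith
  -- continuity
  have hcont : ContinuousAt (fun z : (E n × E n) × (E n × E n) =>
      ⟪(fderiv ℝ (fun x' => Dx c x' y0) z.1.1 - fderiv ℝ (fun x' => Dx c x' z.1.2) z.1.1) z.2.2, z.2.2⟫
      + (a + 2 * ρ) * ⟪z.2.1, e⟫) ((x, y1), (e, η0)) := by
    have c1 : ContinuousAt (fun z : (E n × E n) × (E n × E n) =>
        fderiv ℝ (fun x' => Dx c x' y0) z.1.1) ((x, y1), (e, η0)) := by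
      have : ContinuousAt (fun z : (E n × E n) × (E n × E n) => (z.1.1, y0)) ((x, y1), (e, η0)) := by
        fun_prop
      exact ContinuousAt.comp (g := fun z : E n × E n => fderiv ℝ (fun x' => Dx c x' z.2) z.1)
        (f := fun z : (E n × E n) × (E n × E n) => (z.1.1, y0)) (G.contB hx hy0) this
    have c2 : ContinuousAt (fun z : (E n × E n) × (E n × E n) =>
        fderiv ℝ (fun x' => Dx c x' z.1.2) z.1.1) ((x, y1), (e, η0)) := by
      exact ContinuousAt.comp (g := fun z : E n × E n => fderiv ℝ (fun x' => Dx c x' z.2) z.1)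
        (f := fun z : (E n × E n) × (E n × E n) => z.1) (G.contB hx hy1) continuousAt_fst
    have c3 : ContinuousAt (fun z : (E n × E n) × (E n × E n) => z.2.2) ((x, y1), (e, η0)) := by
      fun_prop
    have c4 : ContinuousAt (fun z : (E n × E n) × (E n × E n) => z.2.1) ((x, y1), (e, η0)) := by
      fun_prop
    exact (((c1.sub c2).clm_apply c3).inner (𝕜 := ℝ) c3).add
      (continuousAt_const.mul (c4.inner (𝕜 := ℝ) continuousAt_const))
  have hcont2 : ContinuousAt (fun z : (E n × E n) × (E n × E n) => ⟪z.2.1, e⟫)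
      ((x, y1), (e, η0)) := by fun_prop
  have hee : 0 < ⟪e, e⟫ := by rw [real_inner_self_eq_norm_sq]; exact epos
  have hA := (hcont.eventually (gt_mem_nhds hneg')).and (hcont2.eventually (lt_mem_nhds hee))
  rw [nhds_prod_eq, Filter.eventually_prod_iff] at hA
  obtain ⟨pV, hV, pW, hW, hVW⟩ := hA
  rw [nhds_prod_eq, Filter.eventually_prod_iff] at hW
  obtain ⟨pW1, hW1, pW2, hW2, hW12⟩ := hW
  obtain ⟨Y, Y0, Yd, Yeq⟩ := G.curve h2 hx hy0 e v hv
  have hN := G.limN hx hy0 Y0 Yd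
  rw [hv, neg_neg] at hN
  have hV' : {z | pV z} ∩ Ω ×ˢ Ωs ∈ 𝓝 (x, y1) :=
    inter_mem hV ((G.oΩ.prod G.oΩs).mem_nhds ⟨hx, hy1⟩)
  have hom := G.open_map h2 hx hy1 hV'
  have hmap : Tendsto (fun p : ℝ × E n => (p.2, Dx c p.2 y0
      - p.1⁻¹ • (Dx c p.2 y0 - Dx c p.2 (Y p.1)))) (𝓝[>] 0 ×ˢ 𝓝 x) (𝓝 (x, Dx c x y1)) := by
    have e1 : Dx c x y1 = Dx c x y0 - e := by rw [← he]; abel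
    rw [e1]
    exact tendsto_snd.prodMk_nhds
      (((G.hasB hx hy0).continuousAt.tendsto.comp tendsto_snd).sub hN)
  have E1 := hmap.eventually hom
  have E2 := hN.eventually hW1
  have E3 : ∀ᶠ θ in 𝓝[>] (0:ℝ), θ ∈ Ioo (0:ℝ) 1 ∧ Dx c x (Y θ) = Dx c x y0 - θ • e ∧ Y θ ∈ Ωs := by
    have t1 : ∀ᶠ θ in 𝓝[>] (0:ℝ), θ ∈ Ioo (0:ℝ) 1 := Ioo_mem_nhdsGT one_pos
    have t2 : ∀ᶠ θ in 𝓝 (0:ℝ), Y θ ∈ Ωs :=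
      Yd.continuousAt.eventually (G.oΩs.mem_nhds (by rw [Y0]; exact hy0))
    exact t1.and (nhdsWithin_le_nhds (Yeq.and t2))
  obtain ⟨pT, hT, pU, hU, hTU⟩ := Filter.eventually_prod_iff.1 (E1.and E2)
  -- the parabolas
  have hz : ContinuousAt (fun p : ℝ × E n => x + p.1 • p.2 + (a / 2 * p.1 ^ 2) • e) (0, η0) := by
    fun_prop
  have hz' : ContinuousAt (fun p : ℝ × E n => p.2 + (2 * (a / 2) * p.1) • e) (0, η0) := by
    fun_prop
  have F1 := (hz.eventually (p := pU) (by simpa using hU)).and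
    (hz'.eventually (p := pW2) (by simpa using hW2))
  have hzΩ := hz.eventually (p := fun q => q ∈ Ω) (by simpa using G.oΩ.mem_nhds hx)
  have F := F1.and hzΩ
  rw [Metric.eventually_nhds_iff] at F
  obtain ⟨δ, hδ, hF⟩ := F
  have R1 : ∀ᶠ t in 𝓝[>] (0:ℝ), t ∈ Ioo 0 δ := Ioo_mem_nhdsGT hδ
  have R2 : ∀ᶠ η in 𝓝 η0, dist η η0 < δ := Metric.ball_mem_nhds η0 hδ
  filter_upwards [R1.prod_mk R2]
  rintro ⟨t1, η⟩ ⟨ht1, hη⟩ heη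
  simp only at ht1 hη heη ⊢
  have hF' : ∀ t ∈ Icc 0 t1, (pU (x + t • η + (a / 2 * t ^ 2) • e) ∧ pW2 (η + (2 * (a / 2) * t) • e))
      ∧ x + t • η + (a / 2 * t ^ 2) • e ∈ Ω := by
    intro t ht
    refine hF (y := (t, η)) ?_
    rw [Prod.dist_eq]
    refine max_lt ?_ hη
    rw [Real.dist_eq]; simp only [sub_zero]; rw [abs_of_nonneg ht.1]; linarith [ht.2, ht1.2]
  have key : ∀ᶠ θ in 𝓝[>] (0:ℝ),
      c (x + t1 • η + (a / 2 * t1 ^ 2) • e) y0 - c (x + t1 • η + (a / 2 * t1 ^ 2) • e) (Y θ)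
      ≤ c x y0 - c x (Y θ) := by
    filter_upwards [hT, E3] with θ hθT hθ
    obtain ⟨hθ1, hθ2, hθ3⟩ := hθ
    have := oneD (t1 := t1) (k := fun t => c (x + t • η + (a / 2 * t ^ 2) • e) y0
        - c (x + t • η + (a / 2 * t ^ 2) • e) (Y θ))
      (k' := fun t => ⟪Dx c (x + t • η + (a / 2 * t ^ 2) • e) y0
        - Dx c (x + t • η + (a / 2 * t ^ 2) • e) (Y θ), η + (2 * (a / 2) * t) • e⟫) ht1.1.le
      (fun t ht => chainI (G.gdiff (hF' t ht).2 hy0 hθ3) (quadD x η e (a / 2) t))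
      (by simp [hθ2, inner_smul_left, heη])
      (by
        intro t ht hk
        set z := x + t • η + (a / 2 * t ^ 2) • e with hzdef
        obtain ⟨⟨hpU, hpW2⟩, hzΩ⟩ := hF' t ht
        obtain ⟨⟨w, hw1, hw2⟩, hw3⟩ := hTU hθT hpU
        simp only at hw1 hw2 hw3
        have hVW' := hVW hw1.1 (hW12 hw3 hpW2)
        simp only at hVW'
        have hst := G.step h3 (a := a) (ρ := ρ) (e := e) (ξ := η + (2 * (a / 2) * t) • e)
          (N := θ⁻¹ • (Dx c z y0 - Dx c z (Y θ))) hzΩ hy0 hw1.2.2 hθ3 hθ1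
          (by rw [hw2]; abel) (by rw [smul_inv_smul₀ hθ1.1.ne'])
          (by rw [inner_smul_left, hk, mul_zero])
          hρ hVW'.2 hVW'.1
        filter_upwards [hst] with h hh
        have ez : x + (t + h) • η + (a / 2 * (t + h) ^ 2) • e
          = z + h • (η + (2 * (a / 2) * t) • e) + (a / 2 * h ^ 2) • e := by
          rw [hzdef]; module
        simp only [ez]
        exact hh)
    simpa using this
  have hz1 : x + t1 • η + (a / 2 * t1 ^ 2) • e ∈ Ω := (hF' t1 ⟨ht1.1.le, le_rfl⟩).2
  set z1 := x + t1 • η + (a / 2 * t1 ^ 2) • e with hz1d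
  have D1 : HasDerivAt (fun θ => c z1 (Y θ) - c x (Y θ)) (⟪Dy c z1 y0, v⟫ - ⟪Dy c x y0, v⟫) 0 :=
    (chainI (by rw [Y0]; exact G.gy z1 hz1 y0 hy0) Yd).sub
      (chainI (by rw [Y0]; exact G.gy x hx y0 hy0) Yd)
  have := deriv_nonneg_of_right D1 (by
    filter_upwards [key] with θ hθ
    rw [Y0]; linarith)
  rw [inner_sub_left]; linarith

end Good

theorem taylor2 {V : Type*} [NormedAddCommGroup V] [InnerProductSpace ℝ V]
    {g : V → ℝ} {g' : V → V} {M : V →L[ℝ] V} {x : V}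
    (hg : ∀ᶠ z in 𝓝 x, HasFDerivAt g (innerSL ℝ (g' z)) z) (hM : HasFDerivAt g' M x)
    {ε : ℝ} (hε : 0 < ε) :
    ∀ᶠ z in 𝓝 x, g x + ⟪g' x, z - x⟫ + ⟪M (z - x), z - x⟫ / 2 - ε * ‖z - x‖ ^ 2 ≤ g z := by
  have h1 := hM.isLittleO.bound hε
  obtain ⟨r, hr, h⟩ := Metric.eventually_nhds_iff.1 (hg.and h1)
  filter_upwards [Metric.ball_mem_nhds x hr] with z hz
  set ζ := z - x with hζ
  have hin : ∀ t ∈ Icc (0:ℝ) 1, dist (x + t • ζ) x < r := by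
    intro t ht
    rw [dist_eq_norm, add_sub_cancel_left, norm_smul, Real.norm_eq_abs, abs_of_nonneg ht.1]
    have : ‖ζ‖ < r := by rw [hζ, ← dist_eq_norm]; exact hz
    nlinarith [norm_nonneg ζ, ht.2]
  have hd : ∀ t ∈ Icc (0:ℝ) 1, HasDerivWithinAt
      (fun t => g (x + t • ζ) - t * ⟪g' x, ζ⟫ - ⟪M ζ, ζ⟫ / 2 * t ^ 2)
      (⟪g' (x + t • ζ), ζ⟫ - ⟪g' x, ζ⟫ - ⟪M ζ, ζ⟫ * t) (Icc 0 1) t := by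
    intro t ht
    have a1 := chainI (h (hin t ht)).1 (lineD x ζ t)
    have a2 : HasDerivAt (fun t : ℝ => t * ⟪g' x, ζ⟫) ⟪g' x, ζ⟫ t := by
      simpa using (hasDerivAt_id t).mul_const ⟪g' x, ζ⟫
    have a3 : HasDerivAt (fun t : ℝ => ⟪M ζ, ζ⟫ / 2 * t ^ 2) (⟪M ζ, ζ⟫ * t) t := by
      refine ((hasDerivAt_pow 2 t).const_mul (⟪M ζ, ζ⟫ / 2)).congr_deriv ?_
      simp; ring
    exact ((a1.sub a2).sub a3).hasDerivWithinAt
  have := norm_image_sub_le_of_norm_deriv_le_segment_01' (C := ε * ‖ζ‖ ^ 2) hd (by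
    intro t ht
    have ht' : t ∈ Icc (0:ℝ) 1 := ⟨ht.1, ht.2.le⟩
    have b := (h (hin t ht')).2
    rw [add_sub_cancel_left, norm_smul, Real.norm_eq_abs, abs_of_nonneg ht.1] at b
    have e1 : ⟪g' (x + t • ζ), ζ⟫ - ⟪g' x, ζ⟫ - ⟪M ζ, ζ⟫ * t
        = ⟪g' (x + t • ζ) - g' x - M (t • ζ), ζ⟫ := by
      rw [inner_sub_left, inner_sub_left, map_smul, inner_smul_left]; simp [mul_comm]
    rw [e1, Real.norm_eq_abs]
    refine (abs_real_inner_le_norm _ _).trans ?_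
    calc _ ≤ (ε * (t * ‖ζ‖)) * ‖ζ‖ := by gcongr
      _ ≤ (ε * (1 * ‖ζ‖)) * ‖ζ‖ := by gcongr; exact ht.2.le
      _ = _ := by ring)
  have e2 : x + (1:ℝ) • ζ = z := by simp [hζ]
  rw [e2, Real.norm_eq_abs] at this
  have := (abs_le.1 this).1
  simp at this
  linarith

namespace Good

variable {n : ℕ} {Ω Ωs : Set (E n)} {c : E n → E n → ℝ}

theorem strictL (G : Good Ω Ωs c) {x y0 v e : E n} (hx : x ∈ Ω) (hy0 : y0 ∈ Ωs)
    (hv : Dxy c x y0 v = -e) (k : E n) :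
    HasStrictFDerivAt (fun x' => ⟪k - Dy c x' y0, v⟫) (innerSL ℝ e) x := by
  have h : ContDiffAt ℝ 1 (fun x' => Dy c x' y0) x :=
    ContDiffAt.comp (g := fun z : E n × E n => Dy c z.1 z.2) (f := fun e => (e, y0)) x
      (G.sR x hx y0 hy0) (contDiffAt_id.prodMk contDiffAt_const)
  have h1 := (h.hasStrictFDerivAt (by norm_num)).const_sub k
  have h2 := (innerSL ℝ v).hasStrictFDerivAt.comp x h1
  have e1 : (innerSL ℝ v).comp (-fderiv ℝ (fun x' => Dy c x' y0) x) = innerSL ℝ e := by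
    ext1 ξ
    have := G.sym x hx y0 hy0 ξ v
    rw [hv, inner_neg_left] at this
    simp [real_inner_comm _ v, ← this]
  rw [e1] at h2
  refine h2.congr_of_eventuallyEq (Eventually.of_forall fun z => ?_)
  simp [real_inner_comm]

set_option maxHeartbeats 1000000 in
theorem K2 (G : Good Ω Ωs c) (h2 : CondA2 Ω Ωs c) (h3 : CondA3v Ω Ωs c)
    {x y0 y1 v η0 e : E n}
    (hx : x ∈ Ω) (hy0 : y0 ∈ Ωs) (hy1 : y1 ∈ Ωs) (he : Dx c x y0 - Dx c x y1 = e) (hne : e ≠ 0)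
    (hv : Dxy c x y0 v = -e) {X : ℝ → E n} (hX0 : X 0 = x) (hX : HasDerivAt X η0 0)
    (heη : ⟪e, η0⟫ = 0)
    (hle : ∀ᶠ t in 𝓝[>] (0:ℝ), c (X t) y0 - c (X t) y1 ≤ c x y0 - c x y1)
    {ε : ℝ} (hε : 0 < ε) :
    ∀ᶠ t in 𝓝[>] (0:ℝ), ⟪Dy c x y0 - Dy c (X t) y0, v⟫ ≤ ε * t ^ 2 := by
  have epos : 0 < ‖e‖ ^ 2 := by have := norm_pos_iff.2 hne; positivity
  set M := fderiv ℝ (fun x' => Dx c x' y0) x - fderiv ℝ (fun x' => Dx c x' y1) x with hM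
  set q := ⟪M η0, η0⟫ with hq
  set ε1 := ε / 8 / (‖η0‖ ^ 2 + 1) with hε1
  have ε1pos : 0 < ε1 := by positivity
  have htay := taylor2 (g := fun x' => c x' y0 - c x' y1) (g' := fun x' => Dx c x' y0 - Dx c x' y1)
    (M := M) (x := x) (by filter_upwards [G.oΩ.mem_nhds hx] with z hz using G.gdiff hz hy0 hy1)
    ((G.hasB' hx hy0).sub (G.hasB' hx hy1)) ε1pos
  have hXt : Tendsto X (𝓝[>] 0) (𝓝 x) := by
    have := hX.continuousAt.tendsto; rw [hX0] at this
    exact this.mono_left nhdsWithin_le_nhds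
  set ζ : ℝ → E n := fun t => t⁻¹ • (X t - x) with hζ
  have hζt : Tendsto ζ (𝓝[>] 0) (𝓝 η0) := by
    have : Tendsto (slope X 0) (𝓝[>] 0) (𝓝 η0) := (hasDerivAt_iff_tendsto_slope.1 hX).mono_left
      (nhdsWithin_mono (0:ℝ) (fun t (ht : 0 < t) => ne_of_gt ht))
    refine this.congr ?_
    intro t; simp [hζ, slope_def_module, hX0]
  have hQt : ∀ᶠ t in 𝓝[>] (0:ℝ), q / 2 - ε / 4 < ⟪M (ζ t), ζ t⟫ / 2 - ε1 * ‖ζ t‖ ^ 2 := by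
    have hc : Continuous (fun u : E n => ⟪M u, u⟫ / 2 - ε1 * ‖u‖ ^ 2) := by fun_prop
    refine ((hc.tendsto η0).comp hζt).eventually (lt_mem_nhds ?_)
    change q / 2 - ε / 4 < q / 2 - ε1 * ‖η0‖ ^ 2
    have : ε1 * ‖η0‖ ^ 2 ≤ ε / 8 := by
      calc ε1 * ‖η0‖ ^ 2 ≤ ε1 * (‖η0‖ ^ 2 + 1) := by gcongr; linarith
        _ = ε / 8 := by rw [hε1]; field_simp
    linarith
  set a := (-q - ε / 2) / ‖e‖ ^ 2 with ha
  have haE : a * ‖e‖ ^ 2 = -q - ε / 2 := by rw [ha]; field_simp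
  have hk1 := G.K1 h2 h3 hx hy0 hy1 he hne hv (η0 := η0) (a := a)
    (by rw [haE]; change q + _ < 0; linarith)
  set η : ℝ → E n := fun t => ζ t - (⟪e, ζ t⟫ / ‖e‖ ^ 2) • e with hη
  have hηt : Tendsto η (𝓝[>] 0) (𝓝 η0) := by
    have hc : Continuous (fun u : E n => u - (⟪e, u⟫ / ‖e‖ ^ 2) • e) := by fun_prop
    have h := (hc.tendsto η0).comp hζt
    have h0 : η0 - (⟪e, η0⟫ / ‖e‖ ^ 2) • e = η0 := by simp [heη]
    rw [h0] at h
    exact h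
  have hηe : ∀ t, ⟪e, η t⟫ = 0 := by
    intro t
    simp only [hη, inner_sub_right, inner_smul_right, real_inner_self_eq_norm_sq]
    field_simp; ring
  have hk1' := (tendsto_id.prodMk hηt).eventually hk1
  set z : ℝ → E n := fun t => x + t • η t + (a / 2 * t ^ 2) • e with hz
  have tt : Tendsto (fun t : ℝ => t) (𝓝[>] 0) (𝓝 0) := tendsto_id.mono_right nhdsWithin_le_nhds
  have hzt : Tendsto z (𝓝[>] 0) (𝓝 x) := by
    have := (tendsto_const_nhds (x := x)).add (tt.smul hηt) |>.add
      (((tt.pow 2).const_mul (a / 2)).smul_const e)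
    simpa using this
  have hs := (G.strictL hx hy0 hv (Dy c x y0)).isLittleO
  have hs' := (hs.comp_tendsto (hXt.prodMk_nhds hzt)).bound (norm_pos_iff.2 hne)
  filter_upwards [hle, hXt.eventually htay, hQt, hk1', hs', self_mem_nhdsWithin]
    with t b1 b2 b3 b4 b5 b6
  have b6 : 0 < t := b6
  have b4 := b4 (hηe t)
  change ⟪Dy c x y0 - Dy c (z t) y0, v⟫ ≤ 0 at b4
  have eX : X t - x = t • ζ t := by simp [hζ, smul_inv_smul₀ b6.ne']
  rw [eX] at b2
  simp only [he, map_smul, inner_smul_left, inner_smul_right, norm_smul, Real.norm_eq_abs,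
    mul_pow, sq_abs] at b2
  simp only [conj_trivial] at b2
  have hsig : t * ⟪e, ζ t⟫ ≤ t ^ 2 * (-q / 2 + ε / 4) := by
    have := mul_le_mul_of_nonneg_left b3.le (sq_nonneg t)
    nlinarith
  have eXz : X t - z t = (t * (⟪e, ζ t⟫ / ‖e‖ ^ 2) - a / 2 * t ^ 2) • e := by
    have : X t = x + t • ζ t := by rw [← eX]; abel
    rw [this]; simp only [hz, hη]; module
  set lam := t * (⟪e, ζ t⟫ / ‖e‖ ^ 2) - a / 2 * t ^ 2 with hlam
  have hlamE : lam * ‖e‖ ^ 2 = t * ⟪e, ζ t⟫ - (-q - ε / 2) / 2 * t ^ 2 := by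
    rw [← haE, hlam]; field_simp
  have hlam2 : lam * ‖e‖ ^ 2 ≤ ε / 2 * t ^ 2 := by rw [hlamE]; nlinarith
  simp only [Function.comp, eXz, innerSL_apply_apply, inner_smul_right,
    real_inner_self_eq_norm_sq, norm_smul, Real.norm_eq_abs] at b5
  have b7 := (abs_le.1 b5).2
  rcases le_total 0 lam with hl | hl
  · rw [abs_of_nonneg hl] at b7
    nlinarith
  · rw [abs_of_nonpos hl] at b7
    have : 0 ≤ ε * t ^ 2 := by positivity
    nlinarith

end Good

namespace Good

variable {n : ℕ} {Ω Ωs : Set (E n)} {c : E n → E n → ℝ}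

theorem contDxy (G : Good Ω Ωs c) {x y : E n} (hx : x ∈ Ω) (hy : y ∈ Ωs) :
    ContinuousAt (fun x' => Dxy c x' y) x := by
  have h1 : ContinuousAt (fderiv ℝ (fun z : E n × E n => Dx c z.1 z.2)) (x, y) :=
    ((G.sP x hx y hy).fderiv_right (m := 0) (by norm_num)).continuousAt
  have h0 : ContinuousAt (fun x' : E n => (x', y)) x := by fun_prop
  have h2 : ContinuousAt (fun x' => (fderiv ℝ (fun z : E n × E n => Dx c z.1 z.2) (x', y)).comp
      (ContinuousLinearMap.inr ℝ (E n) (E n))) x :=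
    (ContinuousAt.comp (f := fun x' : E n => (x', y)) h1 h0).clm_comp continuousAt_const
  refine h2.congr ?_
  filter_upwards [G.oΩ.mem_nhds hx] with z hz
  ext1 u
  simpa using G.Dxy_eq hz hy u

theorem equivDxy (h2 : CondA2 Ω Ωs c) {x y : E n} (hx : x ∈ Ω) (hy : y ∈ Ωs) :
    ∃ A : E n ≃L[ℝ] E n, (A : E n →L[ℝ] E n) = Dxy c x y :=
  ⟨ContinuousLinearEquiv.ofBijective (Dxy c x y)
    (LinearMap.ker_eq_bot.2 (h2 x hx y hy).1) (LinearMap.range_eq_top.2 (h2 x hx y hy).2), by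
    ext1 u; simp⟩

theorem equivR (G : Good Ω Ωs c) (h2 : CondA2 Ω Ωs c) {x y : E n} (hx : x ∈ Ω) (hy : y ∈ Ωs) :
    ∃ A : E n ≃L[ℝ] E n, (A : E n →L[ℝ] E n) = -fderiv ℝ (fun x' => Dy c x' y) x := by
  set R := -fderiv ℝ (fun x' => Dy c x' y) x with hR
  have hinj : Function.Injective R := by
    rw [injective_iff_map_eq_zero]
    intro ξ hξ
    have hξ' : fderiv ℝ (fun x' => Dy c x' y) x ξ = 0 := by
      rw [hR] at hξ; simpa using hξ
    obtain ⟨v, hv⟩ := (h2 x hx y hy).2 ξ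
    have := G.sym x hx y hy ξ v
    rw [hξ', hv, inner_zero_left] at this
    exact inner_self_eq_zero.1 this
  have hsur : Function.Surjective R :=
    (LinearMap.injective_iff_surjective (f := (R : E n →ₗ[ℝ] E n))).1 hinj
  exact ⟨ContinuousLinearEquiv.ofBijective R
    (LinearMap.ker_eq_bot.2 hinj) (LinearMap.range_eq_top.2 hsur), by
    ext1 u; simp⟩

set_option maxHeartbeats 1000000 in
theorem half (G : Good Ω Ωs c) (h1 : CondA1 Ω Ωs c) (h2 : CondA2 Ω Ωs c)
    (hmc : MutuallyCConvex Ω Ωs c) (h3 : CondA3v Ω Ωs c)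
    {x0 x y0 y1 v : E n} (hx0 : x0 ∈ Ω) (hx : x ∈ Ω) (hy0 : y0 ∈ Ωs) (hy1 : y1 ∈ Ωs)
    (hv : Dxy c x0 y0 v = -(Dx c x0 y0 - Dx c x0 y1))
    (hle : c x y0 - c x y1 ≤ c x0 y0 - c x0 y1) :
    ⟪Dy c x0 y0 - Dy c x y0, v⟫ ≤ 0 := by
  by_cases hyy : y0 = y1
  · subst hyy
    have : v = 0 := (h2 x0 hx0 y0 hy0).1 (by rw [hv]; simp)
    simp [this]
  have ene : ∀ z ∈ Ω, Dx c z y0 - Dx c z y1 ≠ 0 := by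
    intro z hz h
    exact hyy (h1.1 z hz hy0 hy1 (by simp only [neg_inj]; exact sub_eq_zero.1 h))
  set q : E n → E n := fun z => -Dy c z y0 with hq
  have qinj : InjOn q Ω := h1.2 y0 hy0
  set X : E n → E n := Function.invFunOn q Ω with hX
  have Xq : ∀ z ∈ Ω, X (q z) = z := fun z hz => qinj.leftInvOn_invFunOn hz
  set vof : E n → E n := fun z =>
    -(ContinuousLinearMap.inverse (Dxy c z y0) (Dx c z y0 - Dx c z y1)) with hvof
  have hvof' : ∀ z ∈ Ω, Dxy c z y0 (vof z) = -(Dx c z y0 - Dx c z y1) := by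
    intro z hz
    obtain ⟨A, hA⟩ := equivDxy h2 hz hy0
    simp only [hvof]
    rw [← hA, ContinuousLinearMap.inverse_equiv, map_neg]
    simp
  have vcont : ∀ z ∈ Ω, ContinuousAt vof z := by
    intro z hz
    obtain ⟨A, hA⟩ := equivDxy h2 hz hy0
    have hi : ContinuousAt ContinuousLinearMap.inverse (Dxy c z y0) := by
      rw [← hA]; exact (contDiffAt_map_inverse (n := 0) A).continuousAt
    have hi2 : ContinuousAt (fun z => ContinuousLinearMap.inverse (Dxy c z y0)) z :=
      ContinuousAt.comp (f := fun z => Dxy c z y0) hi (G.contDxy hz hy0)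
    exact (hi2.clm_apply ((G.hasB hz hy0).continuousAt.sub (G.hasB hz hy1).continuousAt)).neg
  -- local structure
  have loc : ∀ z ∈ Ω, q '' Ω ∈ 𝓝 (q z) ∧ ∃ B : E n →L[ℝ] E n, HasStrictFDerivAt X B (q z) ∧
      ∀ τ, ⟪Dx c z y0 - Dx c z y1, B τ⟫ = ⟪vof z, τ⟫ := by
    intro z hz
    obtain ⟨A, hA⟩ := G.equivR h2 hz hy0
    have h : ContDiffAt ℝ 1 (fun x' => Dy c x' y0) z :=
      ContDiffAt.comp (g := fun z : E n × E n => Dy c z.1 z.2) (f := fun e => (e, y0)) z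
        (G.sR z hz y0 hy0) (contDiffAt_id.prodMk contDiffAt_const)
    have hs : HasStrictFDerivAt q (A : E n →L[ℝ] E n) z := by
      rw [hA]; exact (h.hasStrictFDerivAt (by norm_num)).neg
    refine ⟨?_, A.symm, ?_, ?_⟩
    · rw [← hs.map_nhds_eq_of_equiv]; exact image_mem_map (G.oΩ.mem_nhds hz)
    · apply hs.to_local_left_inverse
      filter_upwards [G.oΩ.mem_nhds hz] with u hu using Xq u hu
    · intro τ
      obtain ⟨ξ, rfl⟩ := A.surjective τ
      have e1 : A ξ = -fderiv ℝ (fun x' => Dy c x' y0) z ξ := by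
        have := DFunLike.congr_fun hA ξ
        simpa using this
      have := G.sym z hz y0 hy0 ξ (vof z)
      rw [hvof' z hz, inner_neg_left] at this
      simp only [ContinuousLinearEquiv.coe_coe, ContinuousLinearEquiv.symm_apply_apply]
      rw [e1, inner_neg_right, real_inner_comm, real_inner_comm _ (vof z), ← this,
        neg_neg, real_inner_comm]
  have := quasi (D := q '' Ω) (G := fun p => c (X p) y0 - c (X p) y1) (G' := fun p => vof (X p))
    (q0 := q x0) (q1 := q x)
    (by
      rw [isOpen_iff_mem_nhds]
      rintro _ ⟨z, hz, rfl⟩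
      exact (loc z hz).1)
    (hmc.2 y0 hy0)
    (by
      rintro _ ⟨z, hz, rfl⟩
      obtain ⟨-, B, hB, hBe⟩ := loc z hz
      have h5 := HasFDerivAt.comp (q z) (g := fun x' => c x' y0 - c x' y1)
        (by rw [Xq z hz]; exact G.gdiff hz hy0 hy1) hB.hasFDerivAt
      refine h5.congr_fderiv ?_
      ext1 τ
      simp only [ContinuousLinearMap.comp_apply, innerSL_apply_apply, Xq z hz]
      exact hBe τ)
    (by
      rintro _ ⟨z, hz, rfl⟩
      obtain ⟨-, B, hB, hBe⟩ := loc z hz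
      refine ContinuousAt.continuousWithinAt ?_
      exact ContinuousAt.comp (f := X) (by rw [Xq z hz]; exact vcont z hz) hB.hasFDerivAt.continuousAt)
    (by
      rintro _ ⟨z, hz, rfl⟩ h0
      rw [Xq z hz] at h0
      have := hvof' z hz
      rw [h0, map_zero] at this
      exact ene z hz (neg_eq_zero.1 this.symm))
    (by
      rintro _ ⟨z, hz, rfl⟩ τ w hτ hw hev
      rw [Xq z hz] at hτ hw
      simp only [Xq z hz] at hev
      obtain ⟨hDn, B, hB, hBe⟩ := loc z hz
      have hc : HasDerivAt (fun t : ℝ => q z + t • τ + t ^ 2 • w) τ 0 := by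
        have := quadD (q z) τ w 1 0
        simpa using this
      have hc0 : q z + (0:ℝ) • τ + (0:ℝ) ^ 2 • w = q z := by simp
      have hXd : HasDerivAt (fun t : ℝ => X (q z + t • τ + t ^ 2 • w)) (B τ) 0 :=
        HasFDerivAt.comp_hasDerivAt (l := X) (l' := B)
          (f := fun t : ℝ => q z + t • τ + t ^ 2 • w) 0 (by simp only [hc0]; exact hB.hasFDerivAt) hc
      have hk := G.K2 h2 h3 hz hy0 hy1 rfl (ene z hz) (hvof' z hz)
        (X := fun t : ℝ => X (q z + t • τ + t ^ 2 • w)) (by simp only [hc0]; exact Xq z hz)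
        hXd (by rw [hBe, hτ]) hev (ε := ⟪vof z, w⟫ / 2) (by linarith)
      have hin : ∀ᶠ t in 𝓝 (0:ℝ), q z + t • τ + t ^ 2 • w ∈ q '' Ω := by
        refine hc.continuousAt.eventually (p := fun p => p ∈ q '' Ω) ?_
        simp only [hc0]; exact hDn
      obtain ⟨t, ⟨ht1, ht2⟩, ht3⟩ := ((hk.and (nhdsWithin_le_nhds hin)).and
        self_mem_nhdsWithin).exists
      have ht3 : 0 < t := ht3
      have e2 : q (X (q z + t • τ + t ^ 2 • w)) = q z + t • τ + t ^ 2 • w :=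
        Function.invFunOn_eq ht2
      have e3 : Dy c z y0 - Dy c (X (q z + t • τ + t ^ 2 • w)) y0 = t • τ + t ^ 2 • w := by
        have e4 : Dy c z y0 = -q z := by simp [hq]
        have e5 : ∀ u, Dy c u y0 = -q u := by intro u; simp [hq]
        rw [e4, e5, e2]; abel
      simp only [e3] at ht1
      rw [inner_add_left, inner_smul_left, inner_smul_left, real_inner_comm, hτ,
        real_inner_comm] at ht1
      simp only [conj_trivial, mul_zero, zero_add] at ht1
      have : 0 < ⟪vof z, w⟫ * t ^ 2 := by positivity
      nlinarith)
    (mem_image_of_mem q hx0) (mem_image_of_mem q hx)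
    (by simp only [Xq x0 hx0, Xq x hx]; exact hle)
  simp only [Xq x0 hx0] at this
  have ev : vof x0 = v := (h2 x0 hx0 y0 hy0).1 (by rw [hv, hvof' x0 hx0])
  have e6 : q x - q x0 = Dy c x0 y0 - Dy c x y0 := by simp only [hq]; abel
  rw [ev, e6, real_inner_comm] at this
  exact this

end Good

theorem realLemma {h d : ℝ → ℝ} (hc : ContinuousOn h (Icc 0 1))
    (hd : ∀ t ∈ Ioo (0:ℝ) 1, HasDerivAt h (d t) t)
    (hp : ∀ t ∈ Ioo (0:ℝ) 1, ∀ t', t < t' → t' ≤ 1 → h t' ≤ h t → d t ≤ 0)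
    {θ θ' : ℝ} (h0 : 0 < θ) (h1 : θ < θ') (h2 : θ' ≤ 1) (hle : h θ' ≤ h 0) : h θ ≤ h 0 := by
  by_contra! hgt
  have hcθ : ContinuousOn h (Icc 0 θ) := hc.mono (Icc_subset_Icc_right (by linarith))
  have hS : IsCompact (Icc 0 θ ∩ h ⁻¹' Iic (h 0)) :=
    isCompact_Icc.of_isClosed_subset (hcθ.preimage_isClosed_of_isClosed isClosed_Icc isClosed_Iic)
      inter_subset_left
  obtain ⟨s, ⟨⟨hs0, hs1⟩, hs2⟩, hs3⟩ := hS.exists_isGreatest ⟨0, ⟨le_rfl, h0.le⟩, le_refl (h 0)⟩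
  have hs2 : h s ≤ h 0 := hs2
  have hsθ : s < θ := lt_of_le_of_ne hs1 (by rintro rfl; linarith)
  obtain ⟨t, ht, hdt⟩ := exists_hasDerivAt_eq_slope h d hsθ
    (hc.mono (Icc_subset_Icc hs0 (by linarith)))
    (fun t ht => hd t ⟨by linarith [ht.1], by linarith [ht.2]⟩)
  have hpos : 0 < d t := by
    rw [hdt]; apply div_pos <;> linarith
  have hth : h 0 < h t := by
    by_contra! hh
    have := hs3 ⟨⟨by linarith [ht.1], ht.2.le⟩, hh⟩
    linarith [ht.1]
  have := hp t ⟨by linarith [ht.1], by linarith [ht.2]⟩ θ' (by linarith [ht.2]) h2 (by linarith)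
  linarith

/-- under A1, A2, mutual c-convexity and A3v, the sections
`S_θ = {x ∈ Ω : c(x,y₀) − c(x₀,y₀) ≤ c(x,y_θ) − c(x₀,y_θ)}` are non-increasing in `θ`. -/
theorem sections_nonincreasing {n : ℕ} (hn : 1 ≤ n)
    (Ω Ωs : Set (E n)) (c : E n → E n → ℝ)
    (hΩ : NiceDomain Ω) (hΩs : NiceDomain Ωs)
    (hc : CostC2 Ω Ωs c) (h1 : CondA1 Ω Ωs c) (h2 : CondA2 Ω Ωs c)
    (hmc : MutuallyCConvex Ω Ωs c) (h3 : CondA3v Ω Ωs c)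
    (x₀ : E n) (hx₀ : x₀ ∈ Ω) (y₀ y₁ : E n) (hy₀ : y₀ ∈ Ωs) (hy₁ : y₁ ∈ Ωs)
    (y : ℝ → E n) (hycont : ContinuousOn y (Icc 0 1)) (hy0 : y 0 = y₀) (hy1 : y 1 = y₁)
    (hymem : ∀ θ ∈ Icc (0:ℝ) 1, y θ ∈ Ωs)
    (hyseg : ∀ θ ∈ Icc (0:ℝ) 1,
      -Dx c x₀ (y θ) = (1 - θ) • (-Dx c x₀ y₀) + θ • (-Dx c x₀ y₁)) :
    ∀ θ θ' : ℝ, 0 ≤ θ → θ ≤ θ' → θ' ≤ 1 →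
      {x ∈ Ω | c x y₀ - c x₀ y₀ ≤ c x (y θ') - c x₀ (y θ')} ⊆
        {x ∈ Ω | c x y₀ - c x₀ y₀ ≤ c x (y θ) - c x₀ (y θ)} := by
  intro θ θ' h0θ hθθ' hθ'1 x hxm
  obtain ⟨hx, hle⟩ := hxm
  have G : Good Ω Ωs c := good_of hΩ.2.1 hΩs.2.1 hc
  refine ⟨hx, ?_⟩
  rcases h0θ.eq_or_lt with rfl | h0
  · rw [hy0]
  rcases hθθ'.eq_or_lt with rfl | hlt
  · exact hle
  set d := Dx c x₀ y₁ - Dx c x₀ y₀ with hd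
  have seg : ∀ t ∈ Icc (0:ℝ) 1, Dx c x₀ (y t) = Dx c x₀ y₀ + t • d := by
    intro t ht
    have := hyseg t ht
    rw [← neg_neg (Dx c x₀ (y t)), this, hd]; module
  have yder : ∀ t ∈ Ioo (0:ℝ) 1, ∃ v, HasDerivAt y v t ∧ Dxy c x₀ (y t) v = d := by
    intro t ht
    have ht' : t ∈ Icc (0:ℝ) 1 := ⟨ht.1.le, ht.2.le⟩
    have hnb : Icc (0:ℝ) 1 ∈ 𝓝 t := Icc_mem_nhds ht.1 ht.2
    obtain ⟨A, hA⟩ := Good.equivDxy h2 hx₀ (hymem t ht')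
    have hs : HasStrictFDerivAt (fun y' => Dx c x₀ y') (A : E n →L[ℝ] E n) (y t) := by
      rw [hA]; exact G.hasDxy hx₀ (hymem t ht')
    have yc : ContinuousAt y t := hycont.continuousAt hnb
    have hl := yc.eventually hs.eventually_left_inverse
    have h4 := HasFDerivAt.comp_hasDerivAt (f := fun s : ℝ => Dx c x₀ y₀ + s • d) t
      (by rw [← seg t ht']; exact hs.to_localInverse.hasFDerivAt) (lineD (Dx c x₀ y₀) d t)
    refine ⟨A.symm d, ?_, ?_⟩
    · refine h4.congr_of_eventuallyEq ?_
      filter_upwards [hl, hnb] with s hs1 hs2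
      rw [Function.comp, ← seg s hs2]
      exact hs1.symm
    · rw [← hA]; simp
  choose! v hv1 hv2 using yder
  have key := realLemma (h := fun t => c x₀ (y t) - c x (y t))
    (d := fun t => ⟪Dy c x₀ (y t), v t⟫ - ⟪Dy c x (y t), v t⟫) (θ := θ) (θ' := θ')
    (by
      intro t ht
      have a1 : ContinuousWithinAt (fun t => c x₀ (y t)) (Icc 0 1) t :=
        (G.gy x₀ hx₀ (y t) (hymem t ht)).continuousAt.comp_continuousWithinAt (hycont t ht)
      have a2 : ContinuousWithinAt (fun t => c x (y t)) (Icc 0 1) t :=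
        (G.gy x hx (y t) (hymem t ht)).continuousAt.comp_continuousWithinAt (hycont t ht)
      exact a1.sub a2)
    (fun t ht => (chainI (G.gy x₀ hx₀ (y t) (hymem t ⟨ht.1.le, ht.2.le⟩)) (hv1 t ht)).sub
      (chainI (G.gy x hx (y t) (hymem t ⟨ht.1.le, ht.2.le⟩)) (hv1 t ht)))
    (by
      intro t ht t' htt' ht'1 hh
      have m1 : t ∈ Icc (0:ℝ) 1 := ⟨ht.1.le, ht.2.le⟩
      have m2 : t' ∈ Icc (0:ℝ) 1 := ⟨by linarith [ht.1], ht'1⟩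
      have := G.half h1 h2 hmc h3 hx₀ hx (hymem t m1) (hymem t' m2) (v := (t' - t) • v t)
        (by rw [map_smul, hv2 t ht, seg t m1, seg t' m2]; module)
        (by linarith)
      rw [inner_smul_right, inner_sub_left] at this
      by_contra! hcon
      have := mul_pos (sub_pos.2 htt') hcon
      linarith)
    h0 hlt hθ'1 (by simp only [hy0]; linarith)
  simp only [hy0] at key
  linarith
end
end

section
/- Suppose the C² cost function c satisfies conditions A1, A2, Ω and Ω* are c-convex with respect to each other, and c satisfies condition A3v. Then for every c-convex function φ : Ω → ℝ, every y₀ ∈ Ω* and every h ∈ ℝ, the sub-level set {x ∈ Ω : φ(x) + c(x,y₀) ≤ h} is c-convex with respect to y₀, i.e. its image under x ↦ −D_y c(x,y₀) is a convex subset of ℝⁿ. -/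
open Set Filter Topology MeasureTheory RealInnerProductSpace

noncomputable section

lemma aux_taylor {V : Type*} [NormedAddCommGroup V] [NormedSpace ℝ V] {g : V → ℝ} {x : V}
    (hg : ContDiffAt ℝ 2 g x) :
    (fun z => g z - g x - fderiv ℝ g x (z - x) -
      (1/2) * fderiv ℝ (fderiv ℝ g) x (z - x) (z - x)) =o[𝓝 x] fun z => ‖z - x‖ ^ 2 := by
  have hsymm : IsSymmSndFDerivAt ℝ g x := hg.isSymmSndFDerivAt (by simp)
  have h1 : ContDiffAt ℝ 1 (fderiv ℝ g) x := hg.fderiv_right (by norm_num)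
  have hd : DifferentiableAt ℝ (fderiv ℝ g) x := h1.differentiableAt (by norm_num)
  have hev : ∀ᶠ z in 𝓝 x, DifferentiableAt ℝ g z := by
    have := hg.eventually (by simp)
    filter_upwards [this] with z hz
    exact hz.differentiableAt (by norm_num)
  obtain ⟨r, hr, hball⟩ := Metric.eventually_nhds_iff_ball.1 hev
  set B := fderiv ℝ (fderiv ℝ g) x with hB
  have key := Convex.isLittleO_pow_succ (s := Metric.ball x r) (x₀ := x) (n := 1)
    (f := fun z => g z - g x - fderiv ℝ g x (z - x) - (1/2) * B (z - x) (z - x))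
    (f' := fun z => fderiv ℝ g z - fderiv ℝ g x - B (z - x))
    (convex_ball x r) (Metric.mem_ball_self hr) ?_ ?_
  · rw [Metric.isOpen_ball.nhdsWithin_eq (Metric.mem_ball_self hr)] at key
    simpa using key
  · intro z hz
    apply HasFDerivAt.hasFDerivWithinAt
    have e1 := (hball z hz).hasFDerivAt
    have e0 : HasFDerivAt (fun z : V => z - x) (ContinuousLinearMap.id ℝ V) z :=
      (hasFDerivAt_id z).sub_const x
    have e2 : HasFDerivAt (fun z => fderiv ℝ g x (z - x)) (fderiv ℝ g x) z := by
      have := (fderiv ℝ g x).hasFDerivAt.comp z e0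
      rw [ContinuousLinearMap.comp_id] at this
      exact this
    have e3 : HasFDerivAt (fun z => B (z - x)) B z := by
      have := B.hasFDerivAt.comp z e0
      rw [ContinuousLinearMap.comp_id] at this
      exact this
    have e4 := (e3.clm_apply e0).const_mul (1/2 : ℝ)
    have e5 := ((e1.sub_const (g x)).sub e2).sub e4
    convert e5 using 1
    · rfl
    refine ContinuousLinearMap.ext fun u => ?_
    simp
    have hz1 : B z u = B u z := hsymm z u
    have hz2 : B x u = B u x := hsymm x u
    rw [hz1, hz2]
    ring
  · rw [Metric.isOpen_ball.nhdsWithin_eq (Metric.mem_ball_self hr)]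
    have := hd.hasFDerivAt.isLittleO
    simpa using this.norm_right

lemma aux_inner_Dx {n : ℕ} {c : E n → E n → ℝ} {x y : E n}
    (h : DifferentiableAt ℝ (fun p : E n × E n => c p.1 p.2) (x, y)) :
    HasFDerivAt (fun x' => c x' y)
      ((fderiv ℝ (fun p : E n × E n => c p.1 p.2) (x, y)).comp
        (ContinuousLinearMap.inl ℝ (E n) (E n))) x ∧
    ∀ ξ, ⟪Dx c x y, ξ⟫ = fderiv ℝ (fun p : E n × E n => c p.1 p.2) (x, y) (ξ, 0) := by
  have h1 : HasFDerivAt (fun x' => c x' y)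
      ((fderiv ℝ (fun p : E n × E n => c p.1 p.2) (x, y)).comp
        (ContinuousLinearMap.inl ℝ (E n) (E n))) x := by
    have := HasFDerivAt.comp (f := fun x' => (x', y)) x h.hasFDerivAt (hasFDerivAt_prodMk_left x y)
    exact this
  refine ⟨h1, fun ξ => ?_⟩
  have h2 := h1.differentiableAt.hasGradientAt.hasFDerivAt.unique h1
  have := congrArg (fun L => L ξ) h2
  simpa [Dx] using this

lemma aux_inner_Dy {n : ℕ} {c : E n → E n → ℝ} {x y : E n}
    (h : DifferentiableAt ℝ (fun p : E n × E n => c p.1 p.2) (x, y)) :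
    ∀ ξ, ⟪Dy c x y, ξ⟫ = fderiv ℝ (fun p : E n × E n => c p.1 p.2) (x, y) (0, ξ) := by
  have h1 : HasFDerivAt (fun y' => c x y')
      ((fderiv ℝ (fun p : E n × E n => c p.1 p.2) (x, y)).comp
        (ContinuousLinearMap.inr ℝ (E n) (E n))) y := by
    have := HasFDerivAt.comp (f := fun y' => (x, y')) y h.hasFDerivAt (hasFDerivAt_prodMk_right x y)
    exact this
  intro ξ
  have h2 := h1.differentiableAt.hasGradientAt.hasFDerivAt.unique h1
  have := congrArg (fun L => L ξ) h2
  simpa [Dy] using this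

/-- C² everywhere near the product. -/
def CC2 {n : ℕ} (Ω Ωs : Set (E n)) (c : E n → E n → ℝ) : Prop :=
  ∀ x ∈ Ω, ∀ y ∈ Ωs, ContDiffAt ℝ 2 (fun p : E n × E n => c p.1 p.2) (x, y)

lemma aux_CC2 {n : ℕ} {Ω Ωs : Set (E n)} {c : E n → E n → ℝ} (hc : CostC2 Ω Ωs c) :
    CC2 Ω Ωs c := by
  obtain ⟨U, hU, hs, h⟩ := hc
  intro x hx y hy
  exact h.contDiffAt (hU.mem_nhds (hs ⟨hx, hy⟩))

/-- second derivative of the uncurried cost -/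
def KK {n : ℕ} (c : E n → E n → ℝ) (p : E n × E n) :
    (E n × E n) →L[ℝ] (E n × E n) →L[ℝ] ℝ :=
  fderiv ℝ (fderiv ℝ (fun p : E n × E n => c p.1 p.2)) p

lemma aux_ev_diff {n : ℕ} {c : E n → E n → ℝ} {p : E n × E n}
    (h : ContDiffAt ℝ 2 (fun p : E n × E n => c p.1 p.2) p) :
    ∀ᶠ q in 𝓝 p, DifferentiableAt ℝ (fun p : E n × E n => c p.1 p.2) q := by
  filter_upwards [h.eventually (by simp)] with z hz
  exact hz.differentiableAt (by norm_num)

/-- transposed inclusion from the dual of the product -/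
def toE {n : ℕ} (i : E n →L[ℝ] E n × E n) : ((E n × E n) →L[ℝ] ℝ) →L[ℝ] E n :=
  ((InnerProductSpace.toDual ℝ (E n)).symm.toContinuousLinearEquiv.toContinuousLinearMap).comp
    ((ContinuousLinearMap.compL ℝ (E n) (E n × E n) ℝ).flip i)

lemma toE_inner {n : ℕ} (i : E n →L[ℝ] E n × E n) (L : (E n × E n) →L[ℝ] ℝ) (u : E n) :
    ⟪toE i L, u⟫ = L (i u) := by
  simp [toE]

lemma aux_Dx_eq {n : ℕ} {c : E n → E n → ℝ} {p : E n × E n}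
    (h : DifferentiableAt ℝ (fun p : E n × E n => c p.1 p.2) p) :
    Dx c p.1 p.2 = toE (ContinuousLinearMap.inl ℝ (E n) (E n))
      (fderiv ℝ (fun p : E n × E n => c p.1 p.2) p) := by
  apply ext_inner_right ℝ
  intro u
  rw [toE_inner, (aux_inner_Dx (x := p.1) (y := p.2) h).2]
  rfl

lemma aux_Dy_eq {n : ℕ} {c : E n → E n → ℝ} {p : E n × E n}
    (h : DifferentiableAt ℝ (fun p : E n × E n => c p.1 p.2) p) :
    Dy c p.1 p.2 = toE (ContinuousLinearMap.inr ℝ (E n) (E n))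
      (fderiv ℝ (fun p : E n × E n => c p.1 p.2) p) := by
  apply ext_inner_right ℝ
  intro u
  rw [toE_inner, (aux_inner_Dy (x := p.1) (y := p.2) h)]
  rfl

lemma aux_Dx_strict {n : ℕ} {c : E n → E n → ℝ} {p : E n × E n}
    (h : ContDiffAt ℝ 2 (fun p : E n × E n => c p.1 p.2) p) :
    HasStrictFDerivAt (fun p : E n × E n => Dx c p.1 p.2)
      ((toE (ContinuousLinearMap.inl ℝ (E n) (E n))).comp (KK c p)) p := by
  have h1 : ContDiffAt ℝ 1 (fderiv ℝ (fun p : E n × E n => c p.1 p.2)) p :=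
    h.fderiv_right (by norm_num)
  have h2 := (toE (ContinuousLinearMap.inl ℝ (E n) (E n))).hasStrictFDerivAt.comp p
    (h1.hasStrictFDerivAt (by norm_num))
  refine h2.congr_of_eventuallyEq ?_
  filter_upwards [aux_ev_diff h] with q hq
  exact (aux_Dx_eq hq).symm

lemma aux_Dy_strict {n : ℕ} {c : E n → E n → ℝ} {p : E n × E n}
    (h : ContDiffAt ℝ 2 (fun p : E n × E n => c p.1 p.2) p) :
    HasStrictFDerivAt (fun p : E n × E n => Dy c p.1 p.2)
      ((toE (ContinuousLinearMap.inr ℝ (E n) (E n))).comp (KK c p)) p := by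
  have h1 : ContDiffAt ℝ 1 (fderiv ℝ (fun p : E n × E n => c p.1 p.2)) p :=
    h.fderiv_right (by norm_num)
  have h2 := (toE (ContinuousLinearMap.inr ℝ (E n) (E n))).hasStrictFDerivAt.comp p
    (h1.hasStrictFDerivAt (by norm_num))
  refine h2.congr_of_eventuallyEq ?_
  filter_upwards [aux_ev_diff h] with q hq
  exact (aux_Dy_eq hq).symm

lemma aux_KK_cont {n : ℕ} {c : E n → E n → ℝ} {p : E n × E n}
    (h : ContDiffAt ℝ 2 (fun p : E n × E n => c p.1 p.2) p) : ContinuousAt (KK c) p := by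
  have h1 : ContDiffAt ℝ 1 (fderiv ℝ (fun p : E n × E n => c p.1 p.2)) p :=
    h.fderiv_right (by norm_num)
  have h2 : ContDiffAt ℝ 0 (fderiv ℝ (fderiv ℝ (fun p : E n × E n => c p.1 p.2))) p :=
    h1.fderiv_right (by norm_num)
  exact h2.continuousAt

lemma aux_KK_symm {n : ℕ} {c : E n → E n → ℝ} {p : E n × E n}
    (h : ContDiffAt ℝ 2 (fun p : E n × E n => c p.1 p.2) p) (u v) :
    KK c p u v = KK c p v u :=
  (h.isSymmSndFDerivAt (by simp)) u v

/-- derivative of the map `x ↦ -D_y c(x,y)` -/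
def LL {n : ℕ} (c : E n → E n → ℝ) (p : E n × E n) : E n →L[ℝ] E n :=
  -(((toE (ContinuousLinearMap.inr ℝ (E n) (E n))).comp (KK c p)).comp
    (ContinuousLinearMap.inl ℝ (E n) (E n)))

lemma aux_q_strict {n : ℕ} {c : E n → E n → ℝ} {x y : E n}
    (h : ContDiffAt ℝ 2 (fun p : E n × E n => c p.1 p.2) (x, y)) :
    HasStrictFDerivAt (fun x' => -Dy c x' y) (LL c (x, y)) x := by
  have := HasStrictFDerivAt.comp (f := fun x' => (x', y)) x (aux_Dy_strict h)
    ((hasStrictFDerivAt_id x).prodMk (hasStrictFDerivAt_const y x))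
  exact this.neg

lemma aux_Dxy {n : ℕ} {c : E n → E n → ℝ} {x y : E n}
    (h : ContDiffAt ℝ 2 (fun p : E n × E n => c p.1 p.2) (x, y)) :
    Dxy c x y = ((toE (ContinuousLinearMap.inl ℝ (E n) (E n))).comp (KK c (x, y))).comp
      (ContinuousLinearMap.inr ℝ (E n) (E n)) := by
  have := HasStrictFDerivAt.comp (f := fun y' => (x, y')) y (aux_Dx_strict h)
    ((hasStrictFDerivAt_const x y).prodMk (hasStrictFDerivAt_id y))
  exact this.hasFDerivAt.fderiv

lemma aux_LL_bij {n : ℕ} {c : E n → E n → ℝ} {x y : E n}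
    (h : ContDiffAt ℝ 2 (fun p : E n × E n => c p.1 p.2) (x, y))
    (hb : Function.Bijective (Dxy c x y)) : Function.Bijective (LL c (x, y)) := by
  have hinj : Function.Injective (LL c (x, y)) := by
    rw [injective_iff_map_eq_zero]
    intro ξ hξ
    obtain ⟨η, hη⟩ := hb.2 ξ
    have h1 : ⟪Dxy c x y η, ξ⟫ = KK c (x, y) (0, η) (ξ, 0) := by
      rw [aux_Dxy h]
      simp [toE_inner]
    have h2 : ⟪LL c (x, y) ξ, η⟫ = -KK c (x, y) (ξ, 0) (0, η) := by
      simp [LL, toE_inner]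
    rw [hξ, inner_zero_left, aux_KK_symm h] at h2
    rw [hη, neg_eq_zero.1 h2.symm] at h1
    exact inner_self_eq_zero.1 h1
  exact ⟨hinj, (LinearMap.injective_iff_surjective (f := (LL c (x, y)).toLinearMap)).1 hinj⟩

lemma aux_LL_cont {n : ℕ} {c : E n → E n → ℝ} {x y : E n}
    (h : ContDiffAt ℝ 2 (fun p : E n × E n => c p.1 p.2) (x, y)) :
    ContinuousAt (fun x' => LL c (x', y)) x := by
  have h1 : ContinuousAt (fun x' => KK c (x', y)) x :=
    ContinuousAt.comp (g := KK c) (f := fun x' => (x', y)) (aux_KK_cont h) (by fun_prop)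
  unfold LL
  fun_prop

/-- local solvability `D_x c(x,y') = target`. -/
lemma aux_solve {n : ℕ} {c : E n → E n → ℝ} {x y : E n}
    (h : ContDiffAt ℝ 2 (fun p : E n × E n => c p.1 p.2) (x, y))
    (hb : Function.Bijective (Dxy c x y)) {T : E n → E n} (hT : ContinuousAt T x)
    (hTx : T x = Dx c x y) {N : Set (E n)} (hN : N ∈ 𝓝 y) :
    ∀ᶠ x' in 𝓝 x, ∃ y' ∈ N, Dx c x' y' = T x' := by
  have h1 := (hasStrictFDerivAt_fst (𝕜 := ℝ) (p := (x, y))).prodMk (aux_Dx_strict h)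
  have h2 := h1.map_nhds_eq_of_surj (by
    rw [LinearMap.range_eq_top]
    rintro ⟨u, w⟩
    obtain ⟨η, hη⟩ := hb.2 (w - toE (ContinuousLinearMap.inl ℝ (E n) (E n)) (KK c (x, y) (u, 0)))
    refine ⟨(u, η), ?_⟩
    rw [aux_Dxy h] at hη
    simp at hη
    have : ((u, η) : E n × E n) = (u, 0) + (0, η) := by simp
    simp
    rw [this, map_add, map_add, hη]
    abel)
  have h3 : (fun p : E n × E n => (p.1, Dx c p.1 p.2)) '' (univ ×ˢ N) ∈ 𝓝 (x, Dx c x y) := by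
    have := Filter.image_mem_map (m := fun p : E n × E n => (p.1, Dx c p.1 p.2))
      (prod_mem_nhds (univ_mem (f := 𝓝 x)) hN)
    rwa [h2] at this
  have h4 : ContinuousAt (fun x' => (x', T x')) x := by fun_prop
  have h5 := h4.preimage_mem_nhds (by rw [hTx]; exact h3)
  filter_upwards [h5] with x' hx'
  obtain ⟨⟨a, b⟩, ⟨-, hb'⟩, heq⟩ := hx'
  simp at heq
  obtain ⟨rfl, h6⟩ := heq
  exact ⟨b, hb', h6⟩

lemma aux_T {n : ℕ} {c : E n → E n → ℝ} {x y : E n}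
    (h : ContDiffAt ℝ 2 (fun p : E n × E n => c p.1 p.2) (x, y)) (ξ m : E n) :
    Tendsto (fun r : ℝ => (c (x + (r • ξ + r ^ 2 • m)) y - c x y - r * ⟪Dx c x y, ξ⟫) / r ^ 2)
      (𝓝[>] 0) (𝓝 (⟪Dx c x y, m⟫ + (1/2) * KK c (x, y) (ξ, 0) (ξ, 0))) := by
  have hd := (aux_ev_diff h).self_of_nhds
  have hT := aux_taylor h
  set u : ℝ → E n := fun r => r • ξ + r ^ 2 • m with hu
  have hlim : Tendsto (fun r : ℝ => ((x + u r, y) : E n × E n)) (𝓝[>] 0) (𝓝 (x, y)) := by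
    have : Continuous (fun r : ℝ => ((x + u r, y) : E n × E n)) := by
      simp only [hu]; fun_prop
    have h2 := this.tendsto 0
    simp [hu] at h2
    exact h2.mono_left nhdsWithin_le_nhds
  have h1 := hT.comp_tendsto hlim
  have h2 : (fun r : ℝ => ‖u r‖ ^ 2) =O[𝓝[>] 0] fun r : ℝ => r ^ 2 := by
    have h3 : u =O[𝓝[>] 0] fun r : ℝ => r := by
      have h4 : (fun r : ℝ => ξ + r • m) =O[𝓝[>] 0] fun _ : ℝ => (1 : ℝ) := by
        have : Continuous (fun r : ℝ => ξ + r • m) := by fun_prop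
        exact Tendsto.isBigO_one ℝ ((this.tendsto 0).mono_left nhdsWithin_le_nhds)
      have h5 := (Asymptotics.isBigO_refl (fun r : ℝ => r) (𝓝[>] 0)).smul h4
      refine (h5.congr_left ?_).congr_right (by simp)
      intro r
      simp [hu, smul_smul, pow_two]
    exact h3.norm_left.pow 2
  have h3 := (h1.trans_isBigO (by simpa [Function.comp_def] using h2)).tendsto_div_nhds_zero
  have h4 : Tendsto (fun r : ℝ => ⟪Dx c x y, m⟫ +
      (1/2) * KK c (x, y) (ξ + r • m, 0) (ξ + r • m, 0)) (𝓝[>] 0)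
      (𝓝 (⟪Dx c x y, m⟫ + (1/2) * KK c (x, y) (ξ, 0) (ξ, 0))) := by
    have : Continuous (fun r : ℝ => ⟪Dx c x y, m⟫ +
      (1/2) * KK c (x, y) (ξ + r • m, 0) (ξ + r • m, 0)) := by fun_prop
    have h2 := this.tendsto 0
    simp only [zero_smul, add_zero] at h2
    exact h2.mono_left nhdsWithin_le_nhds
  have h5 := h3.add h4
  rw [zero_add] at h5
  refine h5.congr' ?_
  filter_upwards [self_mem_nhdsWithin] with r (hr : 0 < r)
  have e1 : ((x + u r, y) : E n × E n) - (x, y) = r • ((ξ + r • m, 0) : E n × E n) := by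
    simp [hu, smul_smul, pow_two]
  have e2 : fderiv ℝ (fun p : E n × E n => c p.1 p.2) (x, y) (ξ + r • m, 0) =
      ⟪Dx c x y, ξ⟫ + r * ⟪Dx c x y, m⟫ := by
    rw [← (aux_inner_Dx hd).2, inner_add_right, inner_smul_right]
  simp only [Function.comp_def, e1, map_smul, e2]
  simp only [KK, smul_eq_mul, smul_apply]
  field_simp
  ring

lemma aux_A3 {n : ℕ} {Ω Ωs : Set (E n)} {c : E n → E n → ℝ} (hΩ : IsOpen Ω)
    (hc : CC2 Ω Ωs c) (h3 : CondA3v Ω Ωs c) {x y₀ y' z : E n} (hx : x ∈ Ω) (hy₀ : y₀ ∈ Ωs)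
    (hy' : y' ∈ Ωs) (hz : z ∈ Ωs) {t : ℝ} (ht : t ∈ Ioo (0:ℝ) 1)
    (hN : Dx c x y₀ - Dx c x y' ≠ 0)
    (hzt : Dx c x y₀ - Dx c x z = t • (Dx c x y₀ - Dx c x y'))
    {ξ : E n} (hξ : ⟪Dx c x y₀ - Dx c x y', ξ⟫ = 0) :
    KK c (x, y₀) (ξ, 0) (ξ, 0) - KK c (x, z) (ξ, 0) (ξ, 0) ≤
      t * (KK c (x, y₀) (ξ, 0) (ξ, 0) - KK c (x, y') (ξ, 0) (ξ, 0)) := by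
  set N := Dx c x y₀ - Dx c x y' with hNdef
  set H0 := KK c (x, y₀) (ξ, 0) (ξ, 0) with hH0
  set H1 := KK c (x, y') (ξ, 0) (ξ, 0) with hH1
  set Hz := KK c (x, z) (ξ, 0) (ξ, 0) with hHz
  have hNpos : 0 < ‖N‖ ^ 2 := by positivity
  set κ : ℝ := -(1/2 * (H0 - H1)) / ‖N‖ ^ 2 with hκ
  have hκ2 : κ * ‖N‖ ^ 2 = -(1/2 * (H0 - H1)) := by
    rw [hκ]; field_simp
  set m : E n := κ • N with hm
  have T0 := aux_T (hc x hx y₀ hy₀) ξ m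
  have T1 := aux_T (hc x hx y' hy') ξ m
  have Tz := aux_T (hc x hx z hz) ξ m
  obtain ⟨η, hη, hineq⟩ := h3 x hx y₀ hy₀ y' hy' t ht z hz (by
    have : Dx c x z = Dx c x y₀ - t • N := by rw [← hzt]; abel
    rw [this, hNdef]; module)
  set u : ℝ → E n := fun r => r • ξ + r ^ 2 • m with hu
  have hucont : Continuous u := by simp only [hu]; fun_prop
  have hu0 : Tendsto u (𝓝[>] 0) (𝓝 0) := by
    have := hucont.tendsto 0
    simp only [hu] at this
    simp at this
    exact this.mono_left nhdsWithin_le_nhds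
  have hΩev : ∀ᶠ r in 𝓝[>] (0:ℝ), x + u r ∈ Ω := by
    have : Tendsto (fun r => x + u r) (𝓝[>] 0) (𝓝 x) := by simpa using hu0.const_add x
    exact this.eventually (hΩ.mem_nhds hx)
  have hηlim : Tendsto (fun r => η ‖u r‖ * ‖u r‖ ^ 2 / r ^ 2) (𝓝[>] 0) (𝓝 0) := by
    have hk : Tendsto (fun r : ℝ => ‖ξ + r • m‖ ^ 2) (𝓝[>] 0) (𝓝 (‖ξ‖ ^ 2)) := by
      have : Continuous (fun r : ℝ => ‖ξ + r • m‖ ^ 2) := by fun_prop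
      have := this.tendsto 0
      simp only [zero_smul, add_zero] at this
      exact this.mono_left nhdsWithin_le_nhds
    -- modified modulus vanishing at zero
    have hη' : Tendsto (fun s => if s = 0 then 0 else η s) (𝓝[≥] 0) (𝓝 0) := by
      rw [← Ioi_insert, nhdsWithin_insert, tendsto_sup]
      refine ⟨?_, ?_⟩
      · rw [tendsto_pure_left]
        intro s hs
        simpa using mem_of_mem_nhds hs
      · refine hη.congr' ?_
        filter_upwards [self_mem_nhdsWithin] with s (hs : 0 < s)
        simp [hs.ne']
    have hun : Tendsto (fun r => ‖u r‖) (𝓝[>] 0) (𝓝[≥] 0) := by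
      rw [tendsto_nhdsWithin_iff]
      exact ⟨by simpa using hu0.norm, Eventually.of_forall fun r => norm_nonneg _⟩
    have := (hη'.comp hun).mul hk
    rw [zero_mul] at this
    refine this.congr' ?_
    filter_upwards [self_mem_nhdsWithin] with r (hr : 0 < r)
    have e : u r = r • (ξ + r • m) := by simp [hu, smul_smul, pow_two]
    have e2 : ‖u r‖ = r * ‖ξ + r • m‖ := by rw [e, norm_smul, Real.norm_of_nonneg hr.le]
    simp only [Function.comp_def]
    split_ifs with h0
    · rw [h0]; simp
    · rw [mul_div_assoc, e2]; field_simp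
  have L1 : Tendsto (fun r : ℝ => max 0
      ((c (x + u r) y₀ - c x y₀ - r * ⟪Dx c x y₀, ξ⟫) / r ^ 2 -
        (c (x + u r) y' - c x y' - r * ⟪Dx c x y', ξ⟫) / r ^ 2)) (𝓝[>] 0) (𝓝 0) := by
    have := (tendsto_const_nhds (x := (0:ℝ)) (f := 𝓝[>] (0:ℝ))).max (T0.sub T1)
    convert this using 2
    have e : ⟪Dx c x y₀, m⟫ - ⟪Dx c x y', m⟫ = κ * ‖N‖ ^ 2 := by
      rw [← inner_sub_left, hm, inner_smul_right, ← hNdef, real_inner_self_eq_norm_sq]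
    rw [eq_comm, max_eq_left]
    linarith
  have L2 := (T0.sub Tz).sub hηlim
  have hle := le_of_tendsto_of_tendsto L2 L1 (by
    filter_upwards [self_mem_nhdsWithin, hΩev] with r (hr : 0 < r) hrΩ
    have hi := hineq _ hrΩ
    rw [add_sub_cancel_left] at hi
    have e1 : r * ⟪Dx c x y₀, ξ⟫ - r * ⟪Dx c x y', ξ⟫ = 0 := by
      rw [← mul_sub, ← inner_sub_left, hξ, mul_zero]
    have e2 : r * ⟪Dx c x y₀, ξ⟫ - r * ⟪Dx c x z, ξ⟫ = 0 := by
      rw [← mul_sub, ← inner_sub_left, hzt, inner_smul_left, hξ]; simp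
    rw [← sub_div, ← sub_div, ← sub_div, ← zero_div (r ^ 2), max_div_div_right (by positivity)]
    gcongr
    rcases max_cases (c x y₀ - c (x + u r) y₀) (c x y' - c (x + u r) y') with h | h
    · refine le_trans ?_ (le_max_left _ _)
      simp only [hu] at *
      linarith
    · refine le_trans ?_ (le_max_right _ _)
      simp only [hu] at *
      linarith)
  have e : ⟪Dx c x y₀, m⟫ - ⟪Dx c x z, m⟫ = t * (κ * ‖N‖ ^ 2) := by
    rw [← inner_sub_left, hzt, hm, inner_smul_right, inner_smul_left, real_inner_self_eq_norm_sq]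
    simp; ring
  rw [hκ2] at e
  linarith

/-- uniform convergence of difference quotients in the `y` variable -/
lemma aux_unif {n : ℕ} {Ω Ωs : Set (E n)} {c : E n → E n → ℝ}
    (hc : CC2 Ω Ωs c) {y₀ : E n} (hy₀ : y₀ ∈ Ωs) (e : E n) {K : Set (E n)} (hK : IsCompact K)
    (hKΩ : K ⊆ Ω) {ε : ℝ} (hε : 0 < ε) :
    ∀ᶠ t in 𝓝 (0:ℝ), ∀ x ∈ K, |c x y₀ - c x (y₀ + t • e) - t * ⟪-Dy c x y₀, e⟫| ≤ ε * |t| := by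
  apply hK.eventually_forall_of_forall_eventually
  intro x hx
  have h2 := hc x (hKΩ hx) y₀ hy₀
  have hs : HasStrictFDerivAt (fun p : E n × E n => c p.1 p.2)
    (fderiv ℝ (fun p : E n × E n => c p.1 p.2) (x, y₀)) (x, y₀) :=
    h2.hasStrictFDerivAt (by norm_num)
  have ha : 0 < ε / (2 * (‖e‖ + 1)) := by positivity
  have h3 := hs.isLittleO.def ha
  have hlim : Tendsto (fun z : ℝ × E n => (((z.2, y₀ + z.1 • e), (z.2, y₀)) :
      (E n × E n) × (E n × E n))) (𝓝 (0, x)) (𝓝 ((x, y₀), (x, y₀))) := by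
    have : Continuous (fun z : ℝ × E n => (((z.2, y₀ + z.1 • e), (z.2, y₀)) :
      (E n × E n) × (E n × E n))) := by fun_prop
    simpa using this.tendsto (0, x)
  have h4 := hlim.eventually h3
  have h5 : ∀ᶠ z : ℝ × E n in 𝓝 (0, x), |⟪Dy c z.2 y₀ - Dy c x y₀, e⟫| < ε / 2 := by
    have hcont : ContinuousAt (fun x' => -Dy c x' y₀) x := (aux_q_strict h2).continuousAt
    have hcont2 : ContinuousAt (fun z : ℝ × E n => -Dy c z.2 y₀) (0, x) :=
      ContinuousAt.comp (g := fun x' => -Dy c x' y₀) (f := fun z : ℝ × E n => z.2) hcont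
        continuousAt_snd
    have hcont3 : ContinuousAt (fun z : ℝ × E n => |⟪Dy c z.2 y₀ - Dy c x y₀, e⟫|) (0, x) := by
      have : ContinuousAt (fun z : ℝ × E n => |⟪-(-Dy c z.2 y₀) - Dy c x y₀, e⟫|) (0, x) := by
        fun_prop
      simpa using this
    apply hcont3.eventually_lt continuousAt_const
    simp; positivity
  filter_upwards [h4, h5] with z h4 h5
  obtain ⟨t, x'⟩ := z
  simp only at h4 h5 ⊢
  have e1 : (((x', y₀ + t • e) : E n × E n) - (x', y₀)) = t • ((0, e) : E n × E n) := by simp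
  rw [e1, map_smul, ← aux_inner_Dy (aux_ev_diff h2).self_of_nhds, norm_smul] at h4
  have e2 : ‖((0, e) : E n × E n)‖ = ‖e‖ := by simp
  rw [e2, Real.norm_eq_abs, Real.norm_eq_abs, smul_eq_mul] at h4
  have h6 : ε / (2 * (‖e‖ + 1)) * (|t| * ‖e‖) ≤ ε / 2 * |t| := by
    have : ε / (2 * (‖e‖ + 1)) * ‖e‖ ≤ ε / 2 := by
      rw [div_mul_eq_mul_div, div_le_div_iff₀ (by positivity) (by positivity)]
      nlinarith [norm_nonneg e]
    calc _ = ε / (2 * (‖e‖ + 1)) * ‖e‖ * |t| := by ring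
      _ ≤ _ := by gcongr
  have h7 : |t * ⟪Dy c x' y₀ - Dy c x y₀, e⟫| ≤ ε / 2 * |t| := by
    rw [abs_mul, mul_comm]; gcongr
  have e3 : c x' y₀ - c x' (y₀ + t • e) - t * ⟪-Dy c x' y₀, e⟫ =
    -(c x' (y₀ + t • e) - c x' y₀ - t * ⟪Dy c x y₀, e⟫) + t * ⟪Dy c x' y₀ - Dy c x y₀, e⟫ := by
    rw [inner_sub_left, inner_neg_left]; ring
  rw [e3]
  calc _ ≤ |-(c x' (y₀ + t • e) - c x' y₀ - t * ⟪Dy c x y₀, e⟫)| +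
        |t * ⟪Dy c x' y₀ - Dy c x y₀, e⟫| := abs_add_le _ _
    _ ≤ _ := by rw [abs_neg]; linarith

lemma aux_notouch {n : ℕ} {Ω Ωs : Set (E n)} {c : E n → E n → ℝ} (hΩ : IsOpen Ω)
    (hΩs : IsOpen Ωs) (hc : CC2 Ω Ωs c) (h2 : CondA2 Ω Ωs c) (h3 : CondA3v Ω Ωs c)
    {x₀ y₀ y₁ : E n} (hx₀ : x₀ ∈ Ω) (hy₀ : y₀ ∈ Ωs) (hy₁ : y₁ ∈ Ωs)
    (hN : Dx c x₀ y₀ - Dx c x₀ y₁ ≠ 0) (e : E n) (P : E n →L[ℝ] E n)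
    (hP : ∀ u w, ⟪P u, w⟫ = ⟪u, P w⟫) {γ : ℝ} (hγ : 0 < γ) {v : E n}
    (hv : ⟪Dx c x₀ y₀ - Dx c x₀ y₁, v⟫ = 0) (hPv : ⟪P v, v⟫ < 0)
    (htouch : ∀ᶠ x in 𝓝 x₀, (c x y₀ - c x y₁) - (c x₀ y₀ - c x₀ y₁) ≤
      ⟪-Dy c x y₀ - -Dy c x₀ y₀, e⟫ + ⟪P (x - x₀), x - x₀⟫ - γ * ‖x - x₀‖ ^ 2) : False := by
  -- the covector field
  set l : E n → E n := fun x => (Dx c x y₀ - Dx c x y₁) - (2:ℝ) • P (x - x₀) with hl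
  have hDxc : ∀ y ∈ Ωs, ContinuousAt (fun x => Dx c x y) x₀ := fun y hy =>
    ContinuousAt.comp (g := fun p : E n × E n => Dx c p.1 p.2) (f := fun x' => (x', y))
      (aux_Dx_strict (hc x₀ hx₀ y hy)).continuousAt (by fun_prop)
  have hD0 := hDxc y₀ hy₀
  have hD1 := hDxc y₁ hy₁
  have hlc : ContinuousAt l x₀ := by simp only [hl]; fun_prop
  have hl0 : l x₀ = Dx c x₀ y₀ - Dx c x₀ y₁ := by simp [hl]
  set N := Dx c x₀ y₀ - Dx c x₀ y₁ with hNdef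
  set ξ : E n → E n := fun x => v - (⟪l x, v⟫ / ⟪l x, N⟫) • N with hξ
  have hNN : ⟪l x₀, N⟫ ≠ 0 := by
    rw [hl0]; exact inner_self_ne_zero.2 hN
  have hξc : ContinuousAt ξ x₀ := by
    have h1 : ContinuousAt (fun x => ⟪l x, v⟫) x₀ := by fun_prop
    have h2 : ContinuousAt (fun x => ⟪l x, N⟫) x₀ := by fun_prop
    have h3 := h1.div h2 hNN
    simp only [hξ]
    exact continuousAt_const.sub (h3.smul continuousAt_const)
  have hξ0 : ξ x₀ = v := by simp [hξ, hl0, hv]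
  -- the strict Hessian inequality in a neighbourhood
  have hW : ∀ᶠ p : (E n × E n) × E n in 𝓝 ((x₀, y₁), v),
      KK c (p.1.1, y₁) (p.2, 0) (p.2, 0) + 2 * ⟪P p.2, p.2⟫ - KK c p.1 (p.2, 0) (p.2, 0) < 0 := by
    have k1 : ContinuousAt (KK c) (x₀, y₁) := aux_KK_cont (hc x₀ hx₀ y₁ hy₁)
    have k2 : ContinuousAt (fun p : (E n × E n) × E n => KK c (p.1.1, y₁)) ((x₀, y₁), v) :=
      ContinuousAt.comp (g := KK c) (f := fun p : (E n × E n) × E n => (p.1.1, y₁)) k1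
        (by fun_prop)
    have k3 : ContinuousAt (fun p : (E n × E n) × E n => KK c p.1) ((x₀, y₁), v) :=
      ContinuousAt.comp (g := KK c) (f := fun p : (E n × E n) × E n => p.1) k1 (by fun_prop)
    have k4 : ContinuousAt (fun p : (E n × E n) × E n => ((p.2, 0) : E n × E n)) ((x₀, y₁), v) :=
      by fun_prop
    have k5 : ContinuousAt (fun p : (E n × E n) × E n => ⟪P p.2, p.2⟫) ((x₀, y₁), v) := by
      fun_prop
    have k6 := (((k2.clm_apply k4).clm_apply k4).add (k5.const_mul 2)).sub
      ((k3.clm_apply k4).clm_apply k4)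
    apply k6.eventually_lt (g := fun _ => (0:ℝ)) continuousAt_const
    simp
    linarith
  rw [nhds_prod_eq, nhds_prod_eq] at hW
  obtain ⟨pa, hpa, pb, hpb, hW⟩ := eventually_prod_iff.1 hW
  obtain ⟨pc, hpc, pd, hpd, hpa⟩ := eventually_prod_iff.1 hpa
  have hsolve := aux_solve (hc x₀ hx₀ y₁ hy₁) (h2 x₀ hx₀ y₁ hy₁) (T := fun x => Dx c x y₀ - l x)
    (hD0.sub hlc) (by rw [hl0, hNdef]; abel)
    (N := {y | pd y} ∩ Ωs) (inter_mem hpd (hΩs.mem_nhds hy₁))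
  have hξN := hξc.eventually (by rw [hξ0]; exact hpb)
  have hlN : ∀ᶠ x in 𝓝 x₀, ⟪l x, N⟫ ≠ 0 := by
    have h2 : ContinuousAt (fun x => ⟪l x, N⟫) x₀ := by fun_prop
    exact h2.eventually_ne hNN
  obtain ⟨r, hr, hball⟩ := Metric.nhds_basis_closedBall.mem_iff.1
    (htouch.and (hsolve.and (hξN.and (hlN.and (hpc.and (hΩ.mem_nhds hx₀))))))
  have hcomp : IsCompact (Metric.closedBall x₀ r) := isCompact_closedBall x₀ r
  have hsub : Metric.closedBall x₀ r ⊆ Ω := fun x hx => (hball hx).2.2.2.2.2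
  have hu := aux_unif hc hy₀ e hcomp hsub (ε := γ * r ^ 2 / 4) (by positivity)
  have hzΩ : ∀ᶠ t in 𝓝 (0:ℝ), y₀ + t • e ∈ Ωs := by
    have : ContinuousAt (fun t : ℝ => y₀ + t • e) 0 := by fun_prop
    exact this.eventually (by simpa using hΩs.mem_nhds hy₀)
  have hall : ∀ᶠ t in 𝓝[>] (0:ℝ), (t ∈ Ioo (0:ℝ) 1) ∧ y₀ + t • e ∈ Ωs ∧ 
      ∀ x ∈ Metric.closedBall x₀ r,
        |c x y₀ - c x (y₀ + t • e) - t * ⟪-Dy c x y₀, e⟫| ≤ γ * r ^ 2 / 4 * |t| :=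
    Eventually.and (show ∀ᶠ t in 𝓝[>] (0:ℝ), t ∈ Ioo (0:ℝ) 1 from Ioo_mem_nhdsGT one_pos)
      ((hzΩ.filter_mono nhdsWithin_le_nhds).and (hu.filter_mono nhdsWithin_le_nhds))
  obtain ⟨t, ht, hz, hu⟩ := hall.exists
  have ht0 : 0 < t := ht.1
  set z := y₀ + t • e with hzdef
  -- the perturbed function and its maximum
  set Φ : E n → ℝ := fun x => t * (c x y₀ - c x y₁) - (c x y₀ - c x z) -
    t * ⟪P (x - x₀), x - x₀⟫ with hΦ
  have hcd : ∀ x ∈ Ω, ∀ y ∈ Ωs, DifferentiableAt ℝ (fun p : E n × E n => c p.1 p.2) (x, y) :=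
    fun x hx y hy => (aux_ev_diff (hc x hx y hy)).self_of_nhds
  have hcc : ∀ x ∈ Ω, ∀ y ∈ Ωs, ContinuousAt (fun x => c x y) x :=
    fun x hx y hy => (aux_inner_Dx (hcd x hx y hy)).1.continuousAt
  have hΦc : ContinuousOn Φ (Metric.closedBall x₀ r) := by
    intro x hx
    apply ContinuousAt.continuousWithinAt
    have a0 := hcc x (hsub hx) y₀ hy₀
    have a1 := hcc x (hsub hx) y₁ hy₁
    have a2 := hcc x (hsub hx) z hz
    simp only [hΦ]
    fun_prop
  obtain ⟨x, hxb, hmax⟩ := hcomp.exists_isMaxOn ⟨x₀, Metric.mem_closedBall_self hr.le⟩ hΦc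
  have hxlt : dist x x₀ < r := by
    by_contra hcon
    have hdist : ‖x - x₀‖ = r := by
      rw [← dist_eq_norm]
      exact le_antisymm hxb (not_lt.1 hcon)
    have m1 : Φ x₀ ≤ Φ x := hmax (Metric.mem_closedBall_self hr.le)
    have m2 := (hball hxb).1
    have m3 := abs_le.1 (hu x hxb)
    have m4 := abs_le.1 (hu x₀ (Metric.mem_closedBall_self hr.le))
    rw [hdist, inner_sub_left] at m2
    rw [abs_of_pos ht0] at m3 m4
    simp only [hΦ, sub_self, map_zero, inner_zero_left, mul_zero] at m1
    have m5 := mul_le_mul_of_nonneg_left m2 ht0.le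
    have m6 : 0 < γ * r ^ 2 * t := by positivity
    nlinarith
  have hxΩ := hsub hxb
  have hloc : IsLocalMax Φ x :=
    hmax.isLocalMax (Filter.mem_of_superset (Metric.isOpen_ball.mem_nhds hxlt)
      Metric.ball_subset_closedBall)
  obtain ⟨-, ⟨y', ⟨hpdy, hy'⟩, hy'eq⟩, hpbx, hlx, hpcx, -⟩ := hball hxb
  have hWx := hW (hpa hpcx hpdy) hpbx
  simp only at hWx
  -- second order information on Φ along lines
  have hexp : ∀ w : E n, Tendsto (fun s : ℝ => (Φ (x + s • w) - Φ x -
      s * (t * ⟪l x, w⟫ - ⟪Dx c x y₀ - Dx c x z, w⟫)) / s ^ 2) (𝓝[>] 0)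
      (𝓝 (t * (1/2 * KK c (x, y₀) (w, 0) (w, 0) - 1/2 * KK c (x, y₁) (w, 0) (w, 0)) -
        (1/2 * KK c (x, y₀) (w, 0) (w, 0) - 1/2 * KK c (x, z) (w, 0) (w, 0)) -
        t * ⟪P w, w⟫)) := by
    intro w
    have T0 := aux_T (hc x hxΩ y₀ hy₀) w 0
    have T1 := aux_T (hc x hxΩ y₁ hy₁) w 0
    have Tz := aux_T (hc x hxΩ z hz) w 0
    simp only [smul_zero, add_zero, inner_zero_right, zero_add] at T0 T1 Tz
    have := (((T0.sub T1).const_mul t).sub (T0.sub Tz)).sub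
      (tendsto_const_nhds (x := t * ⟪P w, w⟫))
    refine this.congr' ?_
    filter_upwards [self_mem_nhdsWithin] with s (hs : 0 < s)
    have e1 : x + s • w - x₀ = (x - x₀) + s • w := by abel
    have e2 : ⟪P (x + s • w - x₀), x + s • w - x₀⟫ = ⟪P (x - x₀), x - x₀⟫ +
        2 * s * ⟪P (x - x₀), w⟫ + s ^ 2 * ⟪P w, w⟫ := by
      rw [e1, map_add, map_smul, inner_add_left, inner_add_right, inner_add_right,
        inner_smul_left, inner_smul_left, inner_smul_right, inner_smul_right, hP w (x - x₀),
        real_inner_comm (P (x - x₀)) w]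
      simp
      ring
    simp only [hΦ, e2, hl, inner_sub_left, inner_smul_left]
    simp
    field_simp
    ring
  have hcrit : ∀ w : E n, t * ⟪l x, w⟫ - ⟪Dx c x y₀ - Dx c x z, w⟫ ≤ 0 := by
    intro w
    have k1 := hexp w
    have k2 : Tendsto (fun s : ℝ => s) (𝓝[>] 0) (𝓝 0) := tendsto_id.mono_left nhdsWithin_le_nhds
    have k3 := (k1.mul k2).add (tendsto_const_nhds
      (x := t * ⟪l x, w⟫ - ⟪Dx c x y₀ - Dx c x z, w⟫))
    rw [mul_zero, zero_add] at k3
    refine le_of_tendsto k3 ?_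
    have hline : Tendsto (fun s : ℝ => x + s • w) (𝓝[>] 0) (𝓝 x) := by
      have : Continuous (fun s : ℝ => x + s • w) := by fun_prop
      have := this.tendsto 0
      simp only [zero_smul, add_zero] at this
      exact this.mono_left nhdsWithin_le_nhds
    filter_upwards [self_mem_nhdsWithin, hline.eventually hloc] with s (hs : 0 < s) hle
    have : (Φ (x + s • w) - Φ x - s * (t * ⟪l x, w⟫ - ⟪Dx c x y₀ - Dx c x z, w⟫)) / s ^ 2 * s +
      (t * ⟪l x, w⟫ - ⟪Dx c x y₀ - Dx c x z, w⟫) = (Φ (x + s • w) - Φ x) / s := by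
      field_simp
      ring
    rw [this]
    exact div_nonpos_of_nonpos_of_nonneg (by linarith) hs.le
  have hzt : Dx c x y₀ - Dx c x z = t • l x := by
    have k := hcrit (t • l x - (Dx c x y₀ - Dx c x z))
    have k2 : ⟪t • l x - (Dx c x y₀ - Dx c x z), t • l x - (Dx c x y₀ - Dx c x z)⟫ ≤ 0 := by
      rw [inner_sub_left, inner_smul_left]
      exact k
    exact (sub_eq_zero.1 (inner_self_eq_zero.1 (le_antisymm k2 real_inner_self_nonneg))).symm
  have hlx' : Dx c x y₀ - Dx c x y' = l x := by rw [hy'eq]; abel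
  have hlξ : ⟪l x, ξ x⟫ = 0 := by
    simp only [hξ, inner_sub_right, inner_smul_right]
    field_simp
    ring
  have hA := aux_A3 hΩ hc h3 hxΩ hy₀ hy' hz ht (by
    rw [hlx']; intro h0; rw [h0] at hlx; simp at hlx) (by rw [hlx', hzt]) (ξ := ξ x)
    (by rw [hlx', hlξ])
  have hsec : t * (1/2 * KK c (x, y₀) (ξ x, 0) (ξ x, 0) - 1/2 * KK c (x, y₁) (ξ x, 0) (ξ x, 0)) -
        (1/2 * KK c (x, y₀) (ξ x, 0) (ξ x, 0) - 1/2 * KK c (x, z) (ξ x, 0) (ξ x, 0)) -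
        t * ⟪P (ξ x), ξ x⟫ ≤ 0 := by
    refine le_of_tendsto (hexp (ξ x)) ?_
    have hline : Tendsto (fun s : ℝ => x + s • ξ x) (𝓝[>] 0) (𝓝 x) := by
      have : Continuous (fun s : ℝ => x + s • ξ x) := by fun_prop
      have := this.tendsto 0
      simp only [zero_smul, add_zero] at this
      exact this.mono_left nhdsWithin_le_nhds
    filter_upwards [self_mem_nhdsWithin, hline.eventually hloc] with s (hs : 0 < s) hle
    rw [hzt, inner_smul_left, hlξ]
    simp only [mul_zero, sub_zero]
    exact div_nonpos_of_nonpos_of_nonneg (by linarith) (by positivity)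
  have := mul_neg_of_pos_of_neg ht0 hWx
  nlinarith

lemma aux_touch {n : ℕ} {K : Set (E n)} (hK : IsOpen K) {F : E n → ℝ} (hF : ContinuousOn F K)
    {a b m : E n} (hab : a ≠ b) (hseg : segment ℝ a b ⊆ K) (hm : m ∈ segment ℝ a b)
    (ha : F a < F m) (hb : F b < F m) :
    ∃ T : Set (E n), IsCompact T ∧ T ⊆ K ∧ ∃ e : E n, ‖e‖ = 1 ∧ ∃ ℓ : ℝ, 0 < ℓ ∧ ∃ κ : ℝ, 0 < κ ∧
      ∃ ε0 : ℝ, 0 < ε0 ∧ ∀ ε, 0 < ε → ε < ε0 → ∃ q₀ ∈ T, 0 ≤ ⟪q₀ - a, e⟫ ∧ ⟪q₀ - a, e⟫ ≤ ℓ ∧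
      IsLocalMax (fun q => F q - (κ * (‖q - a‖ ^ 2 - ⟪q - a, e⟫ ^ 2) - ε * ⟪q - a, e⟫ ^ 2)) q₀ := by
  have haK : a ∈ K := hseg (left_mem_segment ℝ a b)
  have hbK : b ∈ K := hseg (right_mem_segment ℝ a b)
  have hmK : m ∈ K := hseg hm
  set ℓ := ‖b - a‖ with hℓ
  have hℓ0 : 0 < ℓ := norm_pos_iff.2 (sub_ne_zero.2 hab.symm)
  set e : E n := ℓ⁻¹ • (b - a) with he
  have he1 : ‖e‖ = 1 := by
    rw [he, norm_smul, norm_inv, Real.norm_of_nonneg hℓ0.le, ← hℓ, inv_mul_cancel₀ hℓ0.ne']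
  have hba : b = a + ℓ • e := by
    rw [he, smul_smul, mul_inv_cancel₀ hℓ0.ne']; simp
  have hproj : ∀ q : E n, ‖q - (a + ⟪q - a, e⟫ • e)‖ ^ 2 = ‖q - a‖ ^ 2 - ⟪q - a, e⟫ ^ 2 := by
    intro q
    have e1 : q - (a + ⟪q - a, e⟫ • e) = (q - a) - ⟪q - a, e⟫ • e := by abel
    rw [e1, norm_sub_sq_real, inner_smul_right, norm_smul, he1]
    simp; ring
  have hsegmem : ∀ s : ℝ, 0 ≤ s → s ≤ ℓ → a + s • e ∈ segment ℝ a b := by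
    intro s h0 h1
    rw [segment_eq_image']
    refine ⟨s / ℓ, ⟨by positivity, (div_le_one hℓ0).2 h1⟩, ?_⟩
    simp only [he, smul_smul]; rfl
  obtain ⟨sm, hsm0, hsmℓ, hsm⟩ : ∃ s : ℝ, 0 ≤ s ∧ s ≤ ℓ ∧ m = a + s • e := by
    rw [segment_eq_image'] at hm
    obtain ⟨θ, ⟨h0, h1⟩, rfl⟩ := hm
    refine ⟨θ * ℓ, by positivity, by nlinarith, ?_⟩
    rw [mul_smul, he, smul_smul ℓ, mul_inv_cancel₀ hℓ0.ne', one_smul]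
  have hee : ⟪e, e⟫ = 1 := by rw [real_inner_self_eq_norm_sq, he1]; norm_num
  have hsmi : ⟪m - a, e⟫ = sm := by
    rw [hsm]; simp [inner_smul_left, he1]
  have hmn : ‖m - a‖ ^ 2 = sm ^ 2 := by
    rw [hsm]; simp [norm_smul, he1]
  obtain ⟨δ, hδ, hda, hdb⟩ : ∃ δ > 0, F a < F m - δ ∧ F b < F m - δ := by
    refine ⟨min (F m - F a) (F m - F b) / 2, ?_, ?_, ?_⟩
    · have := lt_min (sub_pos.2 ha) (sub_pos.2 hb); linarith
    · have := min_le_left (F m - F a) (F m - F b); linarith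
    · have := min_le_right (F m - F a) (F m - F b); linarith
  have hsegc : IsCompact (segment ℝ a b) := by
    rw [segment_eq_image']
    exact isCompact_Icc.image (by fun_prop)
  obtain ⟨ρ1, hρ1, hρ1K⟩ := hsegc.exists_cthickening_subset_open hK hseg
  obtain ⟨ρ2, hρ2, hρ2a⟩ := Metric.nhds_basis_closedBall.mem_iff.1
    ((hF.continuousAt (hK.mem_nhds haK)).eventually_lt continuousAt_const hda)
  obtain ⟨ρ3, hρ3, hρ3b⟩ := Metric.nhds_basis_closedBall.mem_iff.1
    ((hF.continuousAt (hK.mem_nhds hbK)).eventually_lt continuousAt_const hdb)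
  set ρ := min ρ1 (min ρ2 ρ3) with hρ
  have hρ0 : 0 < ρ := lt_min hρ1 (lt_min hρ2 hρ3)
  have hρ1' : ρ ≤ ρ1 := min_le_left _ _
  have hρ2' : ρ ≤ ρ2 := (min_le_right _ _).trans (min_le_left _ _)
  have hρ3' : ρ ≤ ρ3 := (min_le_right _ _).trans (min_le_right _ _)
  set T : Set (E n) := {q | 0 ≤ ⟪q - a, e⟫ ∧ ⟪q - a, e⟫ ≤ ℓ ∧
    ‖q - a‖ ^ 2 - ⟪q - a, e⟫ ^ 2 ≤ ρ ^ 2} with hT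
  have hTd : ∀ q ∈ T, ‖q - (a + ⟪q - a, e⟫ • e)‖ ≤ ρ := by
    intro q hq
    have := hq.2.2
    rw [← hproj] at this
    exact (sq_le_sq₀ (norm_nonneg _) hρ0.le).1 this
  have hTK : T ⊆ K := by
    intro q hq
    apply hρ1K
    apply Metric.mem_cthickening_of_dist_le q (a + ⟪q - a, e⟫ • e) ρ1 _ (hsegmem _ hq.1 hq.2.1)
    rw [dist_eq_norm]; exact (hTd q hq).trans hρ1'
  have hTcl : IsClosed T := by
    apply IsClosed.and
    · exact isClosed_le (by fun_prop) (by fun_prop)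
    · apply IsClosed.and
      · exact isClosed_le (by fun_prop) (by fun_prop)
      · exact isClosed_le (by fun_prop) (by fun_prop)
  have hTc : IsCompact T := by
    apply (isCompact_closedBall a (ρ + ℓ)).of_isClosed_subset hTcl
    intro q hq
    rw [mem_closedBall_iff_norm]
    have h1 := hq.1
    have h2 := hq.2.1
    have h3 := hq.2.2
    apply abs_le_of_sq_le_sq' _ (by positivity) |>.2
    nlinarith
  have hmT : m ∈ T := by
    refine ⟨?_, ?_, ?_⟩
    · rw [hsmi]; exact hsm0
    · rw [hsmi]; exact hsmℓ
    · rw [hsmi, hmn]; simp; positivity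
  obtain ⟨B, hB⟩ := hTc.exists_bound_of_continuousOn (hF.mono hTK)
  have hB0 : 0 ≤ B := (norm_nonneg _).trans (hB m hmT)
  refine ⟨T, hTc, hTK, e, he1, ℓ, hℓ0, (2 * B + δ + 1) / ρ ^ 2, by positivity, δ / ℓ ^ 2,
    by positivity, ?_⟩
  intro ε hε hε1
  have hεδ : ε * ℓ ^ 2 < δ := (lt_div_iff₀ (by positivity)).1 hε1
  set κ := (2 * B + δ + 1) / ρ ^ 2 with hκ
  have hκ0 : 0 < κ := by positivity
  have hκρ : κ * ρ ^ 2 = 2 * B + δ + 1 := by rw [hκ]; field_simp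
  set G : E n → ℝ := fun q => F q - (κ * (‖q - a‖ ^ 2 - ⟪q - a, e⟫ ^ 2) - ε * ⟪q - a, e⟫ ^ 2)
    with hG
  have hGc : ContinuousOn G T := by
    apply (hF.mono hTK).sub
    fun_prop
  obtain ⟨q₀, hq₀, hmax⟩ := hTc.exists_isMaxOn ⟨m, hmT⟩ hGc
  refine ⟨q₀, hq₀, hq₀.1, hq₀.2.1, ?_⟩
  have hmq : F m ≤ G q₀ := by
    have h1 : G m ≤ G q₀ := hmax hmT
    have h2 : G m = F m + ε * sm ^ 2 := by
      simp only [hG, hsmi, hmn]; ring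
    have : 0 ≤ ε * sm ^ 2 := by positivity
    linarith
  have hw0 : 0 ≤ ‖q₀ - a‖ ^ 2 - ⟪q₀ - a, e⟫ ^ 2 := by rw [← hproj]; positivity
  have hd := hTd q₀ hq₀
  have hs2 : ε * ⟪q₀ - a, e⟫ ^ 2 ≤ ε * ℓ ^ 2 := by
    have := hq₀.1
    have := hq₀.2.1
    gcongr
  have hkw : 0 ≤ κ * (‖q₀ - a‖ ^ 2 - ⟪q₀ - a, e⟫ ^ 2) := by positivity
  have i1 : 0 < ⟪q₀ - a, e⟫ := by
    refine lt_of_le_of_ne hq₀.1 fun h => ?_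
    rw [← h] at hd
    have : F q₀ < F m - δ := hρ2a (by
      rw [mem_closedBall_iff_norm]; simp at hd; exact hd.trans hρ2')
    have e1 : G q₀ ≤ F q₀ := by
      simp only [hG]; rw [← h] at hkw ⊢; linarith
    linarith
  have i2 : ⟪q₀ - a, e⟫ < ℓ := by
    refine lt_of_le_of_ne hq₀.2.1 fun h => ?_
    rw [h, ← hba] at hd
    have : F q₀ < F m - δ := hρ3b (by
      rw [mem_closedBall_iff_norm]; exact hd.trans hρ3')
    have e1 : G q₀ ≤ F q₀ + ε * ℓ ^ 2 := by
      simp only [hG]; linarith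
    linarith
  have i3 : ‖q₀ - a‖ ^ 2 - ⟪q₀ - a, e⟫ ^ 2 < ρ ^ 2 := by
    refine lt_of_le_of_ne hq₀.2.2 fun h => ?_
    have b1 := (abs_le.1 (hB q₀ hq₀)).2
    have b2 := (abs_le.1 (hB m hmT)).1
    have e1 : G q₀ ≤ F q₀ + ε * ℓ ^ 2 - κ * ρ ^ 2 := by
      simp only [hG]; rw [h]; linarith
    linarith
  apply hmax.isLocalMax
  have o1 : ∀ᶠ q in 𝓝 q₀, 0 < ⟪q - a, e⟫ :=
    ContinuousAt.eventually_lt continuousAt_const (by fun_prop) i1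
  have o2 : ∀ᶠ q in 𝓝 q₀, ⟪q - a, e⟫ < ℓ :=
    ContinuousAt.eventually_lt (by fun_prop) continuousAt_const i2
  have o3 : ∀ᶠ q in 𝓝 q₀, ‖q - a‖ ^ 2 - ⟪q - a, e⟫ ^ 2 < ρ ^ 2 :=
    ContinuousAt.eventually_lt (by fun_prop) continuousAt_const i3
  filter_upwards [o1, o2, o3] with q h1 h2 h3
  exact ⟨h1.le, h2.le, h3.le⟩

/-- the quadratic form of the touching paraboloid -/
def RR {n : ℕ} (κ ε : ℝ) (e : E n) : E n →L[ℝ] E n :=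
  κ • ContinuousLinearMap.id ℝ (E n) - (κ + ε) • (innerSL ℝ e).smulRight e

lemma RR_inner {n : ℕ} (κ ε : ℝ) (e u w : E n) :
    ⟪RR κ ε e u, w⟫ = κ * ⟪u, w⟫ - (κ + ε) * (⟪u, e⟫ * ⟪w, e⟫) := by
  simp [RR, inner_sub_left, inner_smul_left]
  rw [real_inner_comm e u, real_inner_comm e w]
  exact Or.inl rfl

lemma RR_symm {n : ℕ} (κ ε : ℝ) (e u w : E n) : ⟪RR κ ε e u, w⟫ = ⟪u, RR κ ε e w⟫ := by
  rw [real_inner_comm (RR κ ε e w), RR_inner, RR_inner, real_inner_comm u w]; ring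

lemma RR_norm {n : ℕ} (κ ε : ℝ) {e : E n} (he : ‖e‖ = 1) (d : E n) :
    ‖RR κ ε e d‖ ^ 2 = κ ^ 2 * (‖d‖ ^ 2 - ⟪d, e⟫ ^ 2) + ε ^ 2 * ⟪d, e⟫ ^ 2 := by
  have hee : ⟪e, e⟫ = 1 := by rw [real_inner_self_eq_norm_sq, he]; norm_num
  rw [← real_inner_self_eq_norm_sq, RR_inner, real_inner_comm, RR_inner, RR_inner, hee,
    real_inner_self_eq_norm_sq]
  ring

lemma aux_dir {n : ℕ} {κ ε : ℝ} (hκ : 0 < κ) (hε : 0 < ε) {e : E n} (he : ‖e‖ = 1) (d : E n)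
    (h : ε * ⟪d, e⟫ ^ 2 < κ * (‖d‖ ^ 2 - ⟪d, e⟫ ^ 2)) :
    ∃ ξ, ⟪RR κ ε e d, ξ⟫ = 0 ∧ ⟪RR κ ε e ξ, ξ⟫ < 0 := by
  have hee : ⟪e, e⟫ = 1 := by rw [real_inner_self_eq_norm_sq, he]; norm_num
  have hdd := real_inner_self_eq_norm_sq d
  set s := ⟪d, e⟫ with hs
  have hsc : ⟪e, d⟫ = s := real_inner_comm _ _
  set W := ‖d‖ ^ 2 - s ^ 2 with hW
  have hdd' : ⟪d, d⟫ = W + s ^ 2 := by rw [hdd]; ring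
  have hW0 : 0 < W := by
    have : 0 ≤ ε * s ^ 2 := by positivity
    by_contra hc
    nlinarith [not_lt.1 hc]
  set ξ := (κ * W) • e + (ε * s) • (d - s • e) with hξ
  have h1 : ⟪ξ, e⟫ = κ * W := by
    simp only [hξ, inner_add_left, inner_sub_left, inner_smul_left, hee, ← hs]
    simp
  have h2 : ⟪d, ξ⟫ = κ * W * s + ε * s * W := by
    simp only [hξ, inner_add_right, inner_sub_right, inner_smul_right, ← hs, hdd']
    ring
  have h3 : ⟪ξ, ξ⟫ = κ ^ 2 * W ^ 2 + ε ^ 2 * s ^ 2 * W := by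
    have e1 : ⟪ξ, ξ⟫ = (κ * W) * ⟪ξ, e⟫ + (ε * s) * (⟪ξ, d⟫ - s * ⟪ξ, e⟫) := by
      conv_lhs => rw [hξ]
      rw [inner_add_right, inner_smul_right, inner_smul_right, inner_sub_right, inner_smul_right,
        ← hξ]
    rw [e1, real_inner_comm d ξ, h1, h2]; ring
  refine ⟨ξ, ?_, ?_⟩
  · rw [RR_inner, h1, h2, ← hs]; ring
  · rw [RR_inner, h1, h3]
    have : κ * (κ ^ 2 * W ^ 2 + ε ^ 2 * s ^ 2 * W) - (κ + ε) * (κ * W * (κ * W)) =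
      -(ε * κ * W * (κ * W - ε * s ^ 2)) := by ring
    rw [this, neg_neg_iff_pos]
    have : 0 < κ * W - ε * s ^ 2 := by linarith
    positivity

lemma aux_quad {n : ℕ} {q : E n → E n} {L : E n →L[ℝ] E n} {x₀ : E n} (hq : HasFDerivAt q L x₀)
    (R : E n →L[ℝ] E n) (hR : ∀ u w, ⟪R u, w⟫ = ⟪u, R w⟫) {γ : ℝ} (hγ : 0 < γ) :
    ∀ᶠ x in 𝓝 x₀, ⟪R (q x - q x₀), q x - q x₀⟫ ≤ ⟪R (L (x - x₀)), L (x - x₀)⟫ +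
      γ * ‖x - x₀‖ ^ 2 := by
  set D := 2 * (‖R‖ * ‖L‖) + ‖R‖ + 1 with hD
  have hD0 : 0 < D := by positivity
  set η := min 1 (γ / D) with hη
  have hη0 : 0 < η := lt_min one_pos (by positivity)
  have hη1 : η ≤ 1 := min_le_left _ _
  have hηD : η * D ≤ γ := (le_div_iff₀ hD0).1 (min_le_right _ _)
  filter_upwards [hq.isLittleO.def hη0] with x hx
  set u := x - x₀
  set r := q x - q x₀ - L u with hr
  have e1 : q x - q x₀ = L u + r := by rw [hr]; abel
  have e2 : ⟪R (L u + r), L u + r⟫ = ⟪R (L u), L u⟫ + 2 * ⟪R (L u), r⟫ + ⟪R r, r⟫ := by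
    rw [map_add, inner_add_left, inner_add_right, inner_add_right, hR r (L u),
      real_inner_comm (R (L u)) r]; ring
  rw [e1, e2]
  have b1 : ⟪R (L u), r⟫ ≤ ‖R‖ * ‖L‖ * ‖u‖ * (η * ‖u‖) := by
    calc _ ≤ ‖R (L u)‖ * ‖r‖ := real_inner_le_norm _ _
      _ ≤ (‖R‖ * (‖L‖ * ‖u‖)) * (η * ‖u‖) := by
        gcongr
        exact (R.le_opNorm _).trans (by gcongr; exact L.le_opNorm _)
      _ = _ := by ring
  have b2 : ⟪R r, r⟫ ≤ ‖R‖ * (η * ‖u‖) * (1 * ‖u‖) := by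
    calc _ ≤ ‖R r‖ * ‖r‖ := real_inner_le_norm _ _
      _ ≤ (‖R‖ * ‖r‖) * ‖r‖ := by gcongr; exact R.le_opNorm _
      _ ≤ (‖R‖ * (η * ‖u‖)) * (1 * ‖u‖) := by
        gcongr
        exact hx.trans (by gcongr)
  have b3 : η * D * ‖u‖ ^ 2 ≤ γ * ‖u‖ ^ 2 := by gcongr
  have b4 : 0 ≤ η * ‖u‖ ^ 2 := by positivity
  rw [hD] at b3
  nlinarith

set_option maxHeartbeats 2000000 in
lemma aux_quasi {n : ℕ} {Ω Ωs : Set (E n)} {c : E n → E n → ℝ} (hΩ : IsOpen Ω)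
    (hΩs : IsOpen Ωs) (hc : CC2 Ω Ωs c) (h1 : CondA1 Ω Ωs c) (h2 : CondA2 Ω Ωs c)
    (hmc : MutuallyCConvex Ω Ωs c) (h3 : CondA3v Ω Ωs c)
    {y₀ y₁ xa xb xm : E n} (hy₀ : y₀ ∈ Ωs) (hy₁ : y₁ ∈ Ωs) (hxa : xa ∈ Ω) (hxb : xb ∈ Ω)
    (hxm : xm ∈ Ω) (hseg : -Dy c xm y₀ ∈ segment ℝ (-Dy c xa y₀) (-Dy c xb y₀)) :
    c xm y₀ - c xm y₁ ≤ max (c xa y₀ - c xa y₁) (c xb y₀ - c xb y₁) := by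
  by_contra hcon
  obtain ⟨hca, hcb⟩ := max_lt_iff.1 (not_le.1 hcon)
  have hne : y₀ ≠ y₁ := by rintro rfl; simp at hca
  set q : E n → E n := fun x => -Dy c x y₀ with hq
  set f : E n → ℝ := fun x => c x y₀ - c x y₁ with hf
  have hinj : InjOn q Ω := h1.2 y₀ hy₀
  have hDf0 : ∀ x ∈ Ω, Dx c x y₀ - Dx c x y₁ ≠ 0 := by
    intro x hx h
    apply hne
    apply h1.1 x hx hy₀ hy₁
    simp only
    rw [sub_eq_zero.1 h]
  have hqd : ∀ x ∈ Ω, HasStrictFDerivAt q (LL c (x, y₀)) x := fun x hx =>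
    aux_q_strict (hc x hx y₀ hy₀)
  have hLb : ∀ x ∈ Ω, Function.Bijective (LL c (x, y₀)) := fun x hx =>
    aux_LL_bij (hc x hx y₀ hy₀) (h2 x hx y₀ hy₀)
  have hmap : ∀ x ∈ Ω, map q (𝓝 x) = 𝓝 (q x) := fun x hx =>
    (hqd x hx).map_nhds_eq_of_surj (LinearMap.range_eq_top.2 (hLb x hx).2)
  have hcd : ∀ x ∈ Ω, ∀ y ∈ Ωs, DifferentiableAt ℝ (fun p : E n × E n => c p.1 p.2) (x, y) :=
    fun x hx y hy => (aux_ev_diff (hc x hx y hy)).self_of_nhds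
  have hcc : ∀ x ∈ Ω, ∀ y ∈ Ωs, ContinuousAt (fun x => c x y) x :=
    fun x hx y hy => (aux_inner_Dx (hcd x hx y hy)).1.continuousAt
  have hfc : ∀ x ∈ Ω, ContinuousAt f x := fun x hx => (hcc x hx y₀ hy₀).sub (hcc x hx y₁ hy₁)
  have hDxc : ∀ x ∈ Ω, ∀ y ∈ Ωs, ContinuousAt (fun x => Dx c x y) x := fun x hx y hy =>
    ContinuousAt.comp (g := fun p : E n × E n => Dx c p.1 p.2) (f := fun x' => (x', y))
      (aux_Dx_strict (hc x hx y hy)).continuousAt (by fun_prop)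
  set K := q '' Ω with hK
  set X := Function.invFunOn q Ω with hX
  have hXq : ∀ x ∈ Ω, X (q x) = x := fun x hx => hinj.leftInvOn_invFunOn hx
  have hKo : IsOpen K := by
    rw [isOpen_iff_mem_nhds]
    rintro _ ⟨x, hx, rfl⟩
    rw [← hmap x hx]
    exact image_mem_map (hΩ.mem_nhds hx)
  have hXc : ∀ x ∈ Ω, ContinuousAt X (q x) := by
    intro x hx
    unfold ContinuousAt
    rw [← hmap x hx, hXq x hx, tendsto_map'_iff]
    refine tendsto_id.congr' ?_
    filter_upwards [hΩ.mem_nhds hx] with x' hx'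
    exact (hXq x' hx').symm
  have hXcK : ContinuousOn X K := by
    rintro _ ⟨x, hx, rfl⟩
    exact (hXc x hx).continuousWithinAt
  have hFc : ContinuousOn (f ∘ X) K := by
    rintro _ ⟨x, hx, rfl⟩
    apply ContinuousAt.continuousWithinAt
    apply ContinuousAt.comp _ (hXc x hx)
    rw [hXq x hx]; exact hfc x hx
  have hKconv : Convex ℝ K := hmc.2 y₀ hy₀
  have hab : q xa ≠ q xb := by
    intro h
    have h' := hseg
    change q xm ∈ segment ℝ (q xa) (q xb) at h'
    rw [← h, segment_same] at h'
    have := hinj hxm hxa h'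
    rw [this] at hca
    exact lt_irrefl _ hca
  obtain ⟨T, hT, hTK, e, he, ℓ, hℓ, κ, hκ, ε0, hε0, htouch⟩ := aux_touch hKo hFc hab
    (hKconv.segment_subset ⟨xa, hxa, rfl⟩ ⟨xb, hxb, rfl⟩) hseg
    (by simp only [Function.comp]
        change f (X (q xa)) < f (X (q xm))
        rw [hXq _ hxa, hXq _ hxm]; exact hca)
    (by simp only [Function.comp]
        change f (X (q xb)) < f (X (q xm))
        rw [hXq _ hxb, hXq _ hxm]; exact hcb)
  have hS : IsCompact (X '' T) := hT.image_of_continuousOn (hXcK.mono hTK)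
  have hSΩ : X '' T ⊆ Ω := by
    rintro _ ⟨p, hp, rfl⟩
    obtain ⟨x, hx, rfl⟩ := hTK hp
    rw [hXq x hx]; exact hx
  have hTne : (X '' T).Nonempty := by
    obtain ⟨p, hp, -⟩ := htouch (ε0 / 2) (by linarith) (by linarith)
    exact ⟨_, p, hp, rfl⟩
  obtain ⟨C, hC⟩ := hS.exists_bound_of_continuousOn (f := fun x => LL c (x, y₀)) (fun x hx =>
    (aux_LL_cont (hc x (hSΩ hx) y₀ hy₀)).continuousWithinAt)
  obtain ⟨x1, hx1, hmin⟩ := hS.exists_isMinOn hTne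
    (f := fun x => ‖Dx c x y₀ - Dx c x y₁‖) (fun x hx =>
    ((hDxc x (hSΩ hx) y₀ hy₀).sub (hDxc x (hSΩ hx) y₁ hy₁)).norm.continuousWithinAt)
  set c0 := ‖Dx c x1 y₀ - Dx c x1 y₁‖ with hc0
  have hc00 : 0 < c0 := norm_pos_iff.2 (hDf0 x1 (hSΩ hx1))
  set D := 4 * C ^ 2 * ℓ ^ 2 * (κ + 1) + 1 with hD
  have hD0 : 0 < D := by positivity
  set ε := min (ε0 / 2) (min 1 (c0 ^ 2 / D / 2)) with hεdef
  have hε : 0 < ε := lt_min (by positivity) (lt_min one_pos (by positivity))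
  have hεε0 : ε < ε0 := (min_le_left _ _).trans_lt (by linarith)
  have hε1 : ε ≤ 1 := (min_le_right _ _).trans (min_le_left _ _)
  have hεD : ε * D < c0 ^ 2 := by
    have : ε ≤ c0 ^ 2 / D / 2 := (min_le_right _ _).trans (min_le_right _ _)
    have h5 : c0 ^ 2 / D / 2 < c0 ^ 2 / D := half_lt_self (by positivity)
    exact (lt_div_iff₀ hD0).1 (this.trans_lt h5)
  obtain ⟨p, hpT, hs0, hsℓ, hloc⟩ := htouch ε hε hεε0
  have hx0S : X p ∈ X '' T := ⟨p, hpT, rfl⟩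
  obtain ⟨x₀, hx₀, rfl⟩ := hTK hpT
  rw [hXq x₀ hx₀] at hx0S
  set d := q x₀ - (-Dy c xa y₀) with hd
  set R := RR κ ε e with hR
  set L := LL c (x₀, y₀) with hL
  have hΨ : ∀ x, κ * (‖q x - -Dy c xa y₀‖ ^ 2 - ⟪q x - -Dy c xa y₀, e⟫ ^ 2) -
      ε * ⟪q x - -Dy c xa y₀, e⟫ ^ 2 = ⟪R d, d⟫ + 2 * ⟪R d, q x - q x₀⟫ +
        ⟪R (q x - q x₀), q x - q x₀⟫ := by
    intro x
    have e1 : q x - -Dy c xa y₀ = d + (q x - q x₀) := by rw [hd]; abel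
    have e2 : ⟪R (d + (q x - q x₀)), d + (q x - q x₀)⟫ = ⟪R d, d⟫ + 2 * ⟪R d, q x - q x₀⟫ +
        ⟪R (q x - q x₀), q x - q x₀⟫ := by
      rw [map_add, inner_add_left, inner_add_right, inner_add_right,
        hR, RR_symm κ ε e (q x - q x₀) d, real_inner_comm (RR κ ε e d) (q x - q x₀)]; ring
    rw [← e2, ← e1, hR, RR_inner, real_inner_self_eq_norm_sq]; ring
  have hloc2 : ∀ᶠ x in 𝓝 x₀, f x - f x₀ ≤ 2 * ⟪R d, q x - q x₀⟫ +
        ⟪R (q x - q x₀), q x - q x₀⟫ := by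
    have := (hqd x₀ hx₀).continuousAt.eventually hloc
    filter_upwards [this, hΩ.mem_nhds hx₀] with x hx hxΩ
    simp only [Function.comp] at hx
    have k0 := hΨ x₀
    simp only [sub_self, inner_zero_right, map_zero, mul_zero, add_zero] at k0
    rw [hXq x hxΩ, hXq x₀ hx₀, hΨ x, k0] at hx
    linarith
  -- gradient identity
  have hgrad : ∀ u, ⟪Dx c x₀ y₀ - Dx c x₀ y₁, u⟫ = 2 * ⟪R d, L u⟫ := by
    have d0 := (aux_inner_Dx (hcd x₀ hx₀ y₀ hy₀))
    have d1 := (aux_inner_Dx (hcd x₀ hx₀ y₁ hy₁))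
    have dq : HasFDerivAt (fun x => q x - q x₀) L x₀ := (hqd x₀ hx₀).hasFDerivAt.sub_const _
    have dR : HasFDerivAt (fun x => R (q x - q x₀)) (R.comp L) x₀ :=
      R.hasFDerivAt.comp x₀ dq
    have dg := (d0.1.sub d1.1).sub ((((hasFDerivAt_const (R d) x₀).inner ℝ dq).const_mul 2).add
      (dR.inner ℝ dq))
    have hz := IsLocalMax.hasFDerivAt_eq_zero (f := fun x => (c x y₀ - c x y₁) -
      (2 * ⟪R d, q x - q x₀⟫ + ⟪R (q x - q x₀), q x - q x₀⟫)) (by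
        filter_upwards [hloc2] with x hx
        simp only [hf] at hx
        simp only [sub_self, inner_zero_right, map_zero, mul_zero, add_zero]
        linarith) dg
    intro u
    have := congrArg (fun A => A u) hz
    simp at this
    rw [inner_sub_left, d0.2, d1.2]
    linarith
  have hNle : ‖Dx c x₀ y₀ - Dx c x₀ y₁‖ ≤ 2 * C * ‖R d‖ := by
    set N := Dx c x₀ y₀ - Dx c x₀ y₁ with hN
    have hNpos : 0 < ‖N‖ := norm_pos_iff.2 (hDf0 x₀ hx₀)
    have k1 := hgrad N
    rw [real_inner_self_eq_norm_sq] at k1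
    have k2 : ⟪R d, L N⟫ ≤ ‖R d‖ * (C * ‖N‖) := by
      calc _ ≤ ‖R d‖ * ‖L N‖ := real_inner_le_norm _ _
        _ ≤ _ := by
          gcongr
          exact (L.le_opNorm N).trans (by gcongr; exact hC x₀ hx0S)
    have k3 : ‖N‖ * ‖N‖ ≤ 2 * C * ‖R d‖ * ‖N‖ := by nlinarith
    exact le_of_mul_le_mul_right k3 hNpos
  have hc0le : c0 ≤ 2 * C * ‖R d‖ := (hmin hx0S).trans hNle
  have hkey : ε * ⟪d, e⟫ ^ 2 < κ * (‖d‖ ^ 2 - ⟪d, e⟫ ^ 2) := by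
    by_contra hcon
    have k1 := not_lt.1 hcon
    have k2 := RR_norm κ ε he d
    have k3 : ⟪d, e⟫ ^ 2 ≤ ℓ ^ 2 := by gcongr
    have k4 : ‖R d‖ ^ 2 ≤ ε * ℓ ^ 2 * (κ + 1) := by
      rw [hR, k2]
      have a1 : κ * (κ * (‖d‖ ^ 2 - ⟪d, e⟫ ^ 2)) ≤ κ * (ε * ⟪d, e⟫ ^ 2) := by gcongr
      have a2 : κ * (ε * ⟪d, e⟫ ^ 2) ≤ κ * (ε * ℓ ^ 2) := by gcongr
      have a3 : ε * (ε * ⟪d, e⟫ ^ 2) ≤ 1 * (ε * ℓ ^ 2) := by gcongr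
      nlinarith
    have k5 : c0 ^ 2 ≤ (2 * C * ‖R d‖) ^ 2 := by gcongr
    have k6 : (2 * C * ‖R d‖) ^ 2 ≤ 4 * C ^ 2 * (ε * ℓ ^ 2 * (κ + 1)) := by
      have : (2 * C * ‖R d‖) ^ 2 = 4 * C ^ 2 * ‖R d‖ ^ 2 := by ring
      rw [this]; gcongr
    rw [hD] at hεD
    nlinarith
  obtain ⟨ξ, hξ1, hξ2⟩ := aux_dir hκ hε he d hkey
  obtain ⟨v, hv⟩ := (hLb x₀ hx₀).2 ξ
  change L v = ξ at hv
  set γ := -⟪RR κ ε e ξ, ξ⟫ / (4 * (‖v‖ ^ 2 + 1)) with hγ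
  have hγ0 : 0 < γ := div_pos (by linarith) (by positivity)
  have hγv : γ * (4 * (‖v‖ ^ 2 + 1)) = -⟪RR κ ε e ξ, ξ⟫ := by
    rw [hγ]; field_simp
  set P : E n →L[ℝ] E n := (ContinuousLinearMap.adjoint L).comp (R.comp L) +
    (2 * γ) • ContinuousLinearMap.id ℝ (E n) with hPdef
  have hP : ∀ u w, ⟪P u, w⟫ = ⟪R (L u), L w⟫ + 2 * γ * ⟪u, w⟫ := by
    intro u w
    simp [hPdef, inner_add_left, inner_smul_left, ContinuousLinearMap.adjoint_inner_left]
  refine aux_notouch hΩ hΩs hc h2 h3 hx₀ hy₀ hy₁ (hDf0 x₀ hx₀) ((2:ℝ) • R d) P ?_ hγ0 (v := v)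
    ?_ ?_ ?_
  · intro u w
    rw [real_inner_comm (P w), hP, hP, hR, RR_symm, real_inner_comm, real_inner_comm u w]
  · rw [hgrad, hv, hξ1, mul_zero]
  · rw [hP, hv, real_inner_self_eq_norm_sq]
    nlinarith [sq_nonneg ‖v‖]
  · filter_upwards [hloc2, aux_quad (hqd x₀ hx₀).hasFDerivAt R (RR_symm κ ε e) hγ0] with x g1 g2
    rw [hP, real_inner_self_eq_norm_sq, inner_smul_right, real_inner_comm (R d)]
    simp only [hf, hq] at g1 g2 ⊢
    linarith

/-- under A1, A2, mutual c-convexity and A3v, for every c-convex `φ`, the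
sub-level set `{x ∈ Ω : φ(x) + c(x,y₀) ≤ h}` is c-convex with respect to `y₀`. -/
theorem potential_sublevel_cConvex {n : ℕ} (hn : 1 ≤ n)
    (Ω Ωs : Set (E n)) (c : E n → E n → ℝ)
    (hΩ : NiceDomain Ω) (hΩs : NiceDomain Ωs)
    (hc : CostC2 Ω Ωs c) (h1 : CondA1 Ω Ωs c) (h2 : CondA2 Ω Ωs c)
    (hmc : MutuallyCConvex Ω Ωs c) (h3 : CondA3v Ω Ωs c) :
    ∀ φ : E n → ℝ, CConvex Ω Ωs c φ → ∀ y₀ ∈ Ωs, ∀ h : ℝ,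
      Convex ℝ ((fun x => -Dy c x y₀) '' {x ∈ Ω | φ x + c x y₀ ≤ h}) := by
  intro φ hφ y₀ hy₀ h
  rw [convex_iff_segment_subset]
  rintro _ ⟨xa, ⟨hxa, hha⟩, rfl⟩ _ ⟨xb, ⟨hxb, hhb⟩, rfl⟩ p hp
  obtain ⟨xm, hxm, rfl⟩ := (hmc.2 y₀ hy₀).segment_subset ⟨xa, hxa, rfl⟩ ⟨xb, hxb, rfl⟩ hp
  refine ⟨xm, ⟨hxm, ?_⟩, rfl⟩
  obtain ⟨y₁, hy₁, l, hl, hlm⟩ := hφ xm hxm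
  have key := aux_quasi hΩ.2.1 hΩs.2.1 (aux_CC2 hc) h1 h2 hmc h3 hy₀ hy₁ hxa hxb hxm hp
  have k1 := hl xa hxa
  have k2 := hl xb hxb
  have k3 : max (c xa y₀ - c xa y₁) (c xb y₀ - c xb y₁) ≤ h + l :=
    max_le (by linarith) (by linarith)
  linarith
end
end
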